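/- arXiv:2403.04396 — 6 statements merged into one kernel-verified Lean document; each statement's English description precedes it below -/
import Mathlib

section
/- For every c > u_H(λ), the integrand s ↦ 1/√((1−s²) − (u_H(λ)/c)^{1−p}·(1−s^{p+1})) is integrable on (0,1), so T(c) := (1/√λ)·∫₀¹ ds/√((1−s²) − (u_H(λ)/c)^{1−p}·(1−s^{p+1})) is finite; and there exists an even C² function u on [−T(c), T(c)] with u(0) = c, u'(0) = 0, u''(x) + λ·u(x) − a·u(x)^p = 0, u(x) > 0 for all x ∈ (−T(c), T(c)), u(±T(c)) = 0, u'(T(c)) < 0, and u strictly decreasing on [0, T(c)]. -/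
open MeasureTheory

/-- The maximum value `u_H(λ) = (2a/((p+1)λ))^{1/(1-p)}` of the degenerate homoclinic. -/
noncomputable def uH (a p lam : ℝ) : ℝ := (2 * a / ((p + 1) * lam)) ^ (1 / (1 - p))

/-- The time map `T(c)`. -/
noncomputable def Tmap (a p lam c : ℝ) : ℝ :=
  (1 / Real.sqrt lam) * ∫ s in Set.Ioo (0 : ℝ) 1,
    1 / Real.sqrt ((1 - s ^ 2) - (uH a p lam / c) ^ (1 - p) * (1 - s ^ (p + 1)))

open Set in
/-- A continuous function whose derivative is given by a continuous `g` off a single point has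
derivative `g` up to the end points of the interval. -/
theorem hasDerivWithinAt_Icc_of_hasDerivAt_off_point {f g : ℝ → ℝ} {A B z : ℝ}
    (hf : Continuous f) (hg : Continuous g)
    (hd : ∀ x ∈ Ioo A B, x ≠ z → HasDerivAt f (g x) x) {x : ℝ} (hx : x ∈ Icc A B) :
    HasDerivWithinAt f (g x) (Icc A B) x := by
  have key : ∀ y ∈ Icc A B, f y = f A + ∫ t in A..y, g t := by
    intro y hy
    have := integral_eq_of_hasDerivAt_off_countable_of_le f g hy.1 (countable_singleton z)
      hf.continuousOn
      (fun t ht => hd t ⟨ht.1.1, ht.1.2.trans_le hy.2⟩ (fun h => ht.2 h))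
      (hg.intervalIntegrable _ _)
    rw [this]; ring
  have hP : HasDerivAt (fun y => f A + ∫ t in A..y, g t) (g x) x :=
    (intervalIntegral.integral_hasDerivAt_right (hg.intervalIntegrable _ _)
      (hg.stronglyMeasurableAtFilter _ _) hg.continuousAt).const_add _
  exact hP.hasDerivWithinAt.congr key (key x hx)

open Set in
/-- A function with two successive derivatives on `s`, the second of which is continuous. -/
theorem contDiffOn_two_of_hasDerivWithinAt {f g h : ℝ → ℝ} {s : Set ℝ} (hs : UniqueDiffOn ℝ s)
    (hf : ∀ x ∈ s, HasDerivWithinAt f (g x) s x) (hg : ∀ x ∈ s, HasDerivWithinAt g (h x) s x)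
    (hh : ContinuousOn h s) :
    ContDiffOn ℝ 2 f s ∧ ∀ x ∈ s, iteratedDerivWithin 2 f s x = h x := by
  have e1 : EqOn (derivWithin f s) g s := fun x hx => (hf x hx).derivWithin (hs x hx)
  have e2 : EqOn (derivWithin g s) h s := fun x hx => (hg x hx).derivWithin (hs x hx)
  constructor
  · rw [show (2 : WithTop ℕ∞) = 1 + 1 by norm_num, contDiffOn_succ_iff_derivWithin hs]
    refine ⟨fun x hx => (hf x hx).differentiableWithinAt, by simp, ContDiffOn.congr ?_ e1⟩
    rw [show (1 : WithTop ℕ∞) = 0 + 1 by norm_num, contDiffOn_succ_iff_derivWithin hs]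
    exact ⟨fun x hx => (hg x hx).differentiableWithinAt, by simp,
      contDiffOn_zero.2 (hh.congr e2)⟩
  · intro x hx
    rw [iteratedDerivWithin_succ, ← e2 hx]
    have e : EqOn (iteratedDerivWithin 1 f s) g s := fun y hy => by
      rw [iteratedDerivWithin_one, e1 hy]
    exact derivWithin_congr e (e hx)

open Set in
/-- Inversion of the time map: the increasing solution of `W' = √F(W)` running from `0` to `1`,
ending at time `0`, extended to a homeomorphism of the line. -/
theorem exists_inverse_time_map {F : ℝ → ℝ} (hF : Continuous F)
    (hpos : ∀ s ∈ Ioo (0 : ℝ) 1, 0 < F s)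
    (hint : IntegrableOn (fun s => 1 / √(F s)) (Ioo 0 1)) :
    ∃ W : ℝ → ℝ, Continuous W ∧ StrictMono W ∧ W 0 = 1 ∧
      W (-∫ s in Ioo (0 : ℝ) 1, 1 / √(F s)) = 0 ∧
      ∀ y, W y ∈ Ioo (0 : ℝ) 1 → HasDerivAt W √(F (W y)) y := by
  set h : ℝ → ℝ := fun s => if s ∈ Ioo (0 : ℝ) 1 then 1 / √(F s) else 1 with hh
  have h_pos : ∀ s, 0 < h s := by
    intro s
    by_cases hs : s ∈ Ioo (0 : ℝ) 1
    · have := Real.sqrt_pos.2 (hpos s hs)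
      simp only [hh, if_pos hs]; positivity
    · simp only [hh, if_neg hs]; norm_num
  have h_int : ∀ a b, IntervalIntegrable h volume a b := by
    intro a b
    have i1 : Integrable ((Ioo (0 : ℝ) 1).indicator fun s => 1 / √(F s) - 1) volume := by
      rw [integrable_indicator_iff measurableSet_Ioo]
      exact hint.sub (integrableOn_const (by simp))
    have : h = fun s => ((Ioo (0 : ℝ) 1).indicator (fun s => 1 / √(F s) - 1)) s + 1 := by
      ext s
      by_cases hs : s ∈ Ioo (0 : ℝ) 1
      · simp only [hh, if_pos hs, indicator_of_mem hs]; ring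
      · simp only [hh, if_neg hs, indicator_of_notMem hs]; ring
    rw [this]
    exact i1.intervalIntegrable.add intervalIntegrable_const
  set H : ℝ → ℝ := fun s => ∫ t in (1 : ℝ)..s, h t with hH
  have H_sub : ∀ a b, H b - H a = ∫ t in a..b, h t := fun a b =>
    intervalIntegral.integral_interval_sub_left (h_int _ _) (h_int _ _)
  have H_mono : StrictMono H := by
    intro a b hab
    rw [← sub_pos, H_sub]
    exact intervalIntegral.intervalIntegral_pos_of_pos_on (h_int _ _) (fun s _ => h_pos s) hab
  have H_cont : Continuous H := intervalIntegral.continuous_primitive h_int 1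
  have H_one : H 1 = 0 := by simp [hH]
  have H_zero : H 0 = -∫ s in Ioo (0 : ℝ) 1, 1 / √(F s) := by
    have : H 0 = -∫ t in (0 : ℝ)..1, h t := by
      simp only [hH]; rw [intervalIntegral.integral_symm]
    rw [this, intervalIntegral.integral_of_le zero_le_one, integral_Ioc_eq_integral_Ioo]
    congr 1
    exact setIntegral_congr_fun measurableSet_Ioo (fun s hs => by simp only [hh, if_pos hs])
  have H_ge : ∀ s, 1 ≤ s → H s = s - 1 := by
    intro s hs
    have : H s = ∫ t in (1 : ℝ)..s, (1 : ℝ) := by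
      refine intervalIntegral.integral_congr fun t ht => ?_
      rw [uIcc_of_le hs] at ht
      exact if_neg fun h => absurd h.2 (not_lt.2 ht.1)
    simpa using this
  have H_le : ∀ s, s ≤ 0 → H s = H 0 + s := by
    intro s hs
    have : H 0 - H s = ∫ t in s..0, (1 : ℝ) := by
      rw [H_sub]
      refine intervalIntegral.integral_congr fun t ht => ?_
      rw [uIcc_of_le hs] at ht
      exact if_neg fun h => absurd h.1 (not_lt.2 ht.2)
    simp at this
    linarith
  have H_surj : Function.Surjective H := by
    refine H_cont.surjective ?_ ?_
    · refine Filter.Tendsto.congr' (f₁ := fun s => s + (-1)) ?_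
        (Filter.tendsto_atTop_add_const_right _ _ Filter.tendsto_id)
      filter_upwards [Filter.eventually_ge_atTop 1] with s hs
      rw [H_ge s hs]; ring
    · refine Filter.Tendsto.congr' (f₁ := fun s => H 0 + s) ?_
        (Filter.tendsto_atBot_add_const_left _ _ Filter.tendsto_id)
      filter_upwards [Filter.eventually_le_atBot 0] with s hs
      rw [H_le s hs]
  let e : ℝ ≃o ℝ := H_mono.orderIsoOfSurjective H H_surj
  have e_apply : ∀ s, e s = H s := fun _ => rfl
  refine ⟨e.symm, e.symm.continuous, e.symm.strictMono, ?_, ?_, ?_⟩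
  · rw [← H_one, ← e_apply, e.symm_apply_apply]
  · rw [← H_zero, ← e_apply, e.symm_apply_apply]
  · intro y hy
    have h_cont : ContinuousOn h (Ioo 0 1) := by
      have : ContinuousOn (fun s => 1 / √(F s)) (Ioo 0 1) :=
        continuousOn_const.div hF.sqrt.continuousOn
          fun s hs => (Real.sqrt_pos.2 (hpos s hs)).ne'
      exact this.congr fun s hs => if_pos hs
    have hd : HasDerivAt H (h (e.symm y)) (e.symm y) :=
      intervalIntegral.integral_hasDerivAt_right (h_int _ _)
        (h_cont.stronglyMeasurableAtFilter isOpen_Ioo _ hy)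
        (h_cont.continuousAt (isOpen_Ioo.mem_nhds hy))
    have := hd.of_local_left_inverse e.symm.continuous.continuousAt (h_pos _).ne'
      (Filter.Eventually.of_forall fun z => e.apply_symm_apply z)
    simpa [hh, if_pos hy, -mem_Ioo] using this

open Set in
/-- The even solution of `w'' = F'(w)/2` with `w 0 = 1`, `w' 0 = 0`, obtained from the first
integral `w' ^ 2 = F(w)`. -/
theorem exists_even_solution {F f : ℝ → ℝ} (hF : Continuous F) (hf : Continuous f)
    (hpos : ∀ s ∈ Ico (0 : ℝ) 1, 0 < F s) (hF1 : F 1 = 0)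
    (hFf : ∀ s ∈ Ioo (0 : ℝ) 1, HasDerivAt F (f s) s)
    (hint : IntegrableOn (fun s => 1 / √(F s)) (Ioo 0 1))
    {L : ℝ} (hL : L = ∫ s in Ioo (0 : ℝ) 1, 1 / √(F s)) :
    0 < L ∧ ∃ w v : ℝ → ℝ, Continuous w ∧ (∀ x, w (-x) = w x) ∧ w 0 = 1 ∧ w L = 0 ∧
      StrictAntiOn w (Icc 0 L) ∧ v 0 = 0 ∧ v L < 0 ∧
      (∀ x ∈ Icc (-L) L, HasDerivWithinAt w (v x) (Icc (-L) L) x) ∧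
      (∀ x ∈ Icc (-L) L, HasDerivWithinAt v (f (w x) / 2) (Icc (-L) L) x) := by
  obtain ⟨W, W_cont, W_mono, W0, WL, W_deriv⟩ :=
    exists_inverse_time_map hF (fun s hs => hpos s (Ioo_subset_Ico_self hs)) hint
  rw [← hL] at WL
  have L_pos : 0 < L := by
    have : W (-L) < W 0 := by rw [W0, WL]; exact zero_lt_one
    linarith [W_mono.lt_iff_lt.1 this]
  have W_mem : ∀ y ∈ Ioo (-L) 0, W y ∈ Ioo (0 : ℝ) 1 := fun y hy =>
    ⟨WL ▸ W_mono hy.1, W0 ▸ W_mono hy.2⟩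
  set w : ℝ → ℝ := fun x => W (-|x|) with hw
  have w_cont : Continuous w := W_cont.comp continuous_abs.neg
  have w_zero : w 0 = 1 := by simp [hw, W0]
  have w_L : w L = 0 := by simp [hw, abs_of_pos L_pos, WL]
  have r_cont : Continuous fun x => √(F (w x)) := (hF.comp w_cont).sqrt
  set v : ℝ → ℝ := fun x => if x ≤ 0 then √(F (w x)) else -√(F (w x)) with hv
  have v_cont : Continuous v := by
    refine Continuous.if_le r_cont r_cont.neg continuous_id continuous_const ?_
    rintro x rfl
    simp [w_zero, hF1]
  have w_mem : ∀ x ∈ Ioo (-L) L, x ≠ 0 → w x ∈ Ioo (0 : ℝ) 1 := fun x hx hx0 =>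
    W_mem _ ⟨neg_lt_neg (abs_lt.2 hx), neg_neg_of_pos (abs_pos.2 hx0)⟩
  have w_deriv : ∀ x ∈ Ioo (-L) L, x ≠ 0 → HasDerivAt w (v x) x := by
    intro x hx hx0
    have hm := w_mem x hx hx0
    rcases lt_or_gt_of_ne hx0 with h | h
    · have := (W_deriv _ hm).comp x (hasDerivAt_abs_neg h).neg
      exact this.congr_deriv (by simp [hv, hw, h.le])
    · have := (W_deriv _ hm).comp x (hasDerivAt_abs_pos h).neg
      exact this.congr_deriv (by simp [hv, hw, h.not_ge])
  have v_deriv : ∀ x ∈ Ioo (-L) L, x ≠ 0 → HasDerivAt v (f (w x) / 2) x := by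
    intro x hx hx0
    have hm := w_mem x hx hx0
    have hFp := hpos _ (Ioo_subset_Ico_self hm)
    have hs : √(F (w x)) ≠ 0 := (Real.sqrt_pos.2 hFp).ne'
    have hr := (((hFf _ hm).comp x (w_deriv x hx hx0)).sqrt hFp.ne')
    rcases lt_or_gt_of_ne hx0 with h | h
    · have hvx : v x = √(F (w x)) := if_pos h.le
      refine (hr.congr_of_eventuallyEq ?_).congr_deriv ?_
      · filter_upwards [Iio_mem_nhds h] with y hy
        exact if_pos (le_of_lt hy)
      · simp only [Function.comp_apply, hvx]; field_simp
    · have hvx : v x = -√(F (w x)) := if_neg h.not_ge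
      refine (hr.neg.congr_of_eventuallyEq ?_).congr_deriv ?_
      · filter_upwards [Ioi_mem_nhds h] with y hy
        exact if_neg (not_le.2 hy)
      · simp only [Function.comp_apply, hvx]; field_simp
  refine ⟨L_pos, w, v, w_cont, fun x => by simp [hw], w_zero, w_L, ?_, ?_, ?_, ?_, ?_⟩
  · intro x hx y hy hxy
    simp only [hw, abs_of_nonneg hx.1, abs_of_nonneg hy.1]
    exact W_mono (neg_lt_neg hxy)
  · simp [hv, w_zero, hF1]
  · simp only [hv, if_neg L_pos.not_ge, w_L]
    exact neg_neg_of_pos (Real.sqrt_pos.2 (hpos 0 ⟨le_rfl, zero_lt_one⟩))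
  · exact fun x hx => hasDerivWithinAt_Icc_of_hasDerivAt_off_point w_cont v_cont w_deriv hx
  · exact fun x hx => hasDerivWithinAt_Icc_of_hasDerivAt_off_point v_cont
      ((hf.comp w_cont).div_const 2) v_deriv hx

/-- Linear lower bound at `s = 1` for the rescaled energy, from `s ^ 2 ≤ s ^ (p + 1)`. -/
theorem mul_one_sub_le_energy {p k s : ℝ} (hp0 : 0 < p) (hp1 : p < 1) (hk0 : 0 ≤ k) (hk1 : k ≤ 1)
    (hs0 : 0 ≤ s) (hs1 : s ≤ 1) :
    (1 - k) * (1 - s) ≤ (1 - s ^ 2) - k * (1 - s ^ (p + 1)) := by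
  have h1 : s ^ 2 ≤ s ^ (p + 1) := by
    rw [← Real.rpow_two]
    exact Real.rpow_le_rpow_of_exponent_ge_of_imp hs0 hs1 (by linarith) (fun _ h => by linarith)
  have h2 : 0 ≤ k * (s ^ (p + 1) - s ^ 2) := mul_nonneg hk0 (sub_nonneg.2 h1)
  have h3 : 0 ≤ (1 - k) * (s - s ^ 2) := mul_nonneg (sub_nonneg.2 hk1) (by nlinarith)
  nlinarith

open Set in
theorem integrableOn_one_div_sqrt_of_mul_one_sub_le {F : ℝ → ℝ} {m : ℝ} (hF : Continuous F)
    (hm : 0 < m) (h : ∀ s ∈ Ioo (0 : ℝ) 1, m * (1 - s) ≤ F s) :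
    IntegrableOn (fun s => 1 / √(F s)) (Ioo 0 1) := by
  have h1 : IntervalIntegrable (fun s : ℝ => (1 - s) ^ (-(1 / 2) : ℝ)) volume 0 1 := by
    have := (intervalIntegral.intervalIntegrable_rpow' (a := 0) (b := 1)
      (r := -(1 / 2)) (by norm_num)).comp_sub_left 1
    simpa using this.symm
  rw [intervalIntegrable_iff_integrableOn_Ioo_of_le zero_le_one] at h1
  refine (h1.const_mul (1 / √m)).mono' ?_ ?_
  · exact (measurable_const.div hF.sqrt.measurable).aestronglyMeasurable
  · refine (ae_restrict_iff' measurableSet_Ioo).2 (Filter.Eventually.of_forall fun s hs => ?_)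
    have h1s : 0 < 1 - s := sub_pos.2 hs.2
    rw [Real.norm_of_nonneg (by positivity), Real.rpow_neg h1s.le, ← Real.sqrt_eq_rpow,
      ← one_div, one_div_mul_one_div, ← Real.sqrt_mul hm.le]
    exact one_div_le_one_div_of_le (Real.sqrt_pos.2 (mul_pos hm h1s))
      (Real.sqrt_le_sqrt (h s hs))

theorem stmt10 (a p lam : ℝ) (ha : 0 < a) (hp0 : 0 < p) (hp1 : p < 1) (hlam : 0 < lam)
    (c : ℝ) (hc : uH a p lam < c) :
    IntegrableOn
      (fun s : ℝ =>
        1 / Real.sqrt ((1 - s ^ 2) - (uH a p lam / c) ^ (1 - p) * (1 - s ^ (p + 1))))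
      (Set.Ioo (0 : ℝ) 1) ∧
    ∃ u : ℝ → ℝ,
      ContDiffOn ℝ 2 u (Set.Icc (-(Tmap a p lam c)) (Tmap a p lam c)) ∧
      (∀ x : ℝ, u (-x) = u x) ∧
      u 0 = c ∧
      derivWithin u (Set.Icc (-(Tmap a p lam c)) (Tmap a p lam c)) 0 = 0 ∧
      (∀ x ∈ Set.Icc (-(Tmap a p lam c)) (Tmap a p lam c),
        iteratedDerivWithin 2 u (Set.Icc (-(Tmap a p lam c)) (Tmap a p lam c)) x
          + lam * u x - a * u x ^ p = 0) ∧
      (∀ x ∈ Set.Ioo (-(Tmap a p lam c)) (Tmap a p lam c), 0 < u x) ∧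
      u (Tmap a p lam c) = 0 ∧ u (-(Tmap a p lam c)) = 0 ∧
      derivWithin u (Set.Icc (-(Tmap a p lam c)) (Tmap a p lam c)) (Tmap a p lam c) < 0 ∧
      StrictAntiOn u (Set.Icc 0 (Tmap a p lam c)) := by
  have hA : 0 < 2 * a / ((p + 1) * lam) := by positivity
  have huH : 0 < uH a p lam := Real.rpow_pos_of_pos hA _
  have hc0 : 0 < c := huH.trans hc
  have hp1' : 0 < 1 - p := sub_pos.2 hp1
  set k : ℝ := (uH a p lam / c) ^ (1 - p) with hk
  have hk0 : 0 < k := by positivity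
  have hk1 : k < 1 := Real.rpow_lt_one (by positivity) ((div_lt_one hc0).2 hc) hp1'
  have hkc : c * lam * (k * (p + 1) / 2) = a * c ^ p := by
    have e1 : uH a p lam ^ (1 - p) = 2 * a / ((p + 1) * lam) := by
      rw [uH, ← Real.rpow_mul hA.le, one_div_mul_cancel hp1'.ne', Real.rpow_one]
    have e2 : c ^ (1 - p) = c / c ^ p := by rw [Real.rpow_sub hc0, Real.rpow_one]
    have : 0 < c ^ p := by positivity
    rw [hk, Real.div_rpow huH.le hc0.le, e1, e2]
    field_simp
  set F : ℝ → ℝ := fun s => (1 - s ^ 2) - k * (1 - s ^ (p + 1)) with hFdef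
  set f : ℝ → ℝ := fun s => -2 * s + k * ((p + 1) * s ^ p) with hfdef
  have hF : Continuous F := by
    have := Real.continuous_rpow_const (q := p + 1) (by linarith)
    fun_prop
  have hf : Continuous f := by
    have := Real.continuous_rpow_const (q := p) hp0.le
    fun_prop
  have hle : ∀ s, 0 ≤ s → s ≤ 1 → (1 - k) * (1 - s) ≤ F s := fun s h0 h1 =>
    mul_one_sub_le_energy hp0 hp1 hk0.le hk1.le h0 h1
  have hk' : 0 < 1 - k := sub_pos.2 hk1
  have hint : IntegrableOn (fun s => 1 / √(F s)) (Set.Ioo 0 1) :=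
    integrableOn_one_div_sqrt_of_mul_one_sub_le hF hk' fun s hs => hle s hs.1.le hs.2.le
  refine ⟨hint, ?_⟩
  have hFf : ∀ s ∈ Set.Ioo (0 : ℝ) 1, HasDerivAt F (f s) s := by
    intro s hs
    have h1 := Real.hasDerivAt_rpow_const (x := s) (p := p + 1) (Or.inl hs.1.ne')
    refine (((hasDerivAt_pow 2 s).const_sub 1).sub ((h1.const_sub 1).const_mul k)).congr_deriv ?_
    simp only [hfdef, add_sub_cancel_right]
    push_cast
    ring
  obtain ⟨L_pos, w, v, w_cont, w_even, w_zero, w_L, w_anti, v_zero, v_L, w_deriv, v_deriv⟩ :=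
    exists_even_solution hF hf
      (fun s hs => (mul_pos hk' (sub_pos.2 hs.2)).trans_le (hle s hs.1 hs.2.le))
      (by simp [hFdef]) hFf hint rfl
  set L : ℝ := ∫ s in Set.Ioo (0 : ℝ) 1, 1 / √(F s) with hLdef
  set r : ℝ := √lam with hr
  have r_pos : 0 < r := Real.sqrt_pos.2 hlam
  have r_sq : r * r = lam := Real.mul_self_sqrt hlam.le
  have hT : Tmap a p lam c = 1 / r * L := rfl
  rw [hT]
  set T : ℝ := 1 / r * L with hTdef
  have T_pos : 0 < T := by positivity
  have rT : r * T = L := by rw [hTdef]; field_simp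
  have hmaps : Set.MapsTo (fun x => r * x) (Set.Icc (-T) T) (Set.Icc (-L) L) := by
    intro x hx
    rw [← rT]
    constructor <;> nlinarith [hx.1, hx.2]
  have hscale : ∀ x s, HasDerivWithinAt (fun x => r * x) r s x := fun x s => by
    simpa using ((hasDerivAt_id x).const_mul r).hasDerivWithinAt
  have d1 : ∀ x ∈ Set.Icc (-T) T,
      HasDerivWithinAt (fun x => c * w (r * x)) (c * (v (r * x) * r)) (Set.Icc (-T) T) x :=
    fun x hx => ((w_deriv _ (hmaps hx)).comp x (hscale x _) hmaps).const_mul c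
  have d2 : ∀ x ∈ Set.Icc (-T) T, HasDerivWithinAt (fun x => c * (v (r * x) * r))
      (c * (f (w (r * x)) / 2 * r * r)) (Set.Icc (-T) T) x :=
    fun x hx => (((v_deriv _ (hmaps hx)).comp x (hscale x _) hmaps).mul_const r).const_mul c
  have hU : UniqueDiffOn ℝ (Set.Icc (-T) T) := uniqueDiffOn_Icc (by linarith)
  obtain ⟨hC2, hsecond⟩ := contDiffOn_two_of_hasDerivWithinAt hU d1 d2
    (by fun_prop)
  have w_even' : ∀ x, w |x| = w x := fun x => by
    rcases abs_choice x with h | h <;> simp [h, w_even]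
  have w_pos : ∀ x, |x| < L → 0 < w x := fun x hx => by
    rw [← w_even', ← w_L]
    exact w_anti ⟨abs_nonneg x, hx.le⟩ ⟨L_pos.le, le_rfl⟩ hx
  have w_nonneg : ∀ x, |x| ≤ L → 0 ≤ w x := fun x hx => by
    rcases hx.lt_or_eq with h | h
    · exact (w_pos x h).le
    · rw [← w_even', h, w_L]
  have zero_mem : (0 : ℝ) ∈ Set.Icc (-T) T := ⟨by linarith, T_pos.le⟩
  have T_mem : T ∈ Set.Icc (-T) T := ⟨by linarith, le_rfl⟩
  refine ⟨fun x => c * w (r * x), hC2, fun x => by simp [w_even], by simp [w_zero], ?_, ?_, ?_,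
    by simp [rT, w_L], by simp [rT, w_L, w_even], ?_, ?_⟩
  · rw [(d1 0 zero_mem).derivWithin (hU 0 zero_mem)]
    simp [v_zero]
  · intro x hx
    rw [hsecond x hx, Real.mul_rpow hc0.le (w_nonneg _ (abs_le.2 (hmaps hx)))]
    simp only [hfdef]
    linear_combination (c * (-w (r * x) + k * (p + 1) / 2 * w (r * x) ^ p)) * r_sq
      + w (r * x) ^ p * hkc
  · intro x hx
    refine mul_pos hc0 (w_pos _ ?_)
    rw [abs_mul, abs_of_pos r_pos, ← rT]
    exact mul_lt_mul_of_pos_left (abs_lt.2 hx) r_pos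
  · rw [(d1 T T_mem).derivWithin (hU T T_mem), rT]
    exact mul_neg_of_pos_of_neg hc0 (mul_neg_of_neg_of_pos v_L r_pos)
  · intro x hx y hy hxy
    have key : ∀ z ∈ Set.Icc 0 T, r * z ∈ Set.Icc 0 L := fun z hz =>
      ⟨mul_nonneg r_pos.le hz.1, rT ▸ mul_le_mul_of_nonneg_left hz.2 r_pos.le⟩
    exact mul_lt_mul_of_pos_left
      (w_anti (key x hx) (key y hy) (mul_lt_mul_of_pos_left hxy r_pos)) hc0
end

section
/- The time map T, defined for c > u_H(λ) by T(c) := (1/√λ)·∫₀¹ ds/√((1−s²) − (u_H(λ)/c)^{1−p}·(1−s^{p+1})), is continuous and strictly decreasing on (u_H(λ), ∞); moreover T(c) → π/(2·√λ) as c → +∞ and T(c) → π/((1−p)·√λ) as c → u_H(λ)⁺. -/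
open MeasureTheory

/-- The integral of the time map as a function of `k = (u_H(λ)/c)^{1-p}`. -/
noncomputable def timeIntegral (p k : ℝ) : ℝ :=
  ∫ s in Set.Ioo (0 : ℝ) 1, 1 / Real.sqrt ((1 - s ^ 2) - k * (1 - s ^ (p + 1)))

lemma integrableOn_and_integral_eq_of_hasDerivAt {f g : ℝ → ℝ}
    (hc : ContinuousOn g (Set.Icc 0 1)) (hd : ∀ s ∈ Set.Ioo (0 : ℝ) 1, HasDerivAt g (f s) s)
    (hf : ∀ s ∈ Set.Ioo (0 : ℝ) 1, 0 ≤ f s) :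
    IntegrableOn f (Set.Ioo 0 1) ∧ ∫ s in Set.Ioo (0 : ℝ) 1, f s = g 1 - g 0 := by
  have hi : IntegrableOn f (Set.Ioc 0 1) :=
    intervalIntegral.integrableOn_deriv_of_nonneg hc hd hf
  refine ⟨hi.mono_set Set.Ioo_subset_Ioc_self, ?_⟩
  rw [← integral_Ioc_eq_integral_Ioo, ← intervalIntegral.integral_of_le zero_le_one]
  exact intervalIntegral.integral_eq_sub_of_hasDerivAt_of_le zero_le_one hc hd
    ((intervalIntegrable_iff_integrableOn_Ioc_of_le zero_le_one).2 hi)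

lemma timeIntegral_zero (p : ℝ) : timeIntegral p 0 = Real.pi / 2 := by
  have h := (integrableOn_and_integral_eq_of_hasDerivAt (g := Real.arcsin)
    (f := fun s => 1 / Real.sqrt ((1 - s ^ 2) - 0 * (1 - s ^ (p + 1))))
    Real.continuous_arcsin.continuousOn (fun s hs => ?_) (fun s _ => by positivity)).2
  · simpa [timeIntegral] using h
  · simpa using Real.hasDerivAt_arcsin (by linarith [hs.1]) hs.2.ne

lemma timeIntegral_one {p : ℝ} (hp1 : p < 1) :
    IntegrableOn (fun s : ℝ => 1 / Real.sqrt ((1 - s ^ 2) - 1 * (1 - s ^ (p + 1))))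
      (Set.Ioo 0 1) ∧ timeIntegral p 1 = Real.pi / (1 - p) := by
  have hq : 0 < 1 - p := by linarith
  have h := integrableOn_and_integral_eq_of_hasDerivAt
    (g := fun s => 2 / (1 - p) * Real.arcsin (s ^ ((1 - p) / 2)))
    (f := fun s => 1 / Real.sqrt ((1 - s ^ 2) - 1 * (1 - s ^ (p + 1))))
    ?_ (fun s hs => ?_) (fun s _ => by positivity)
  · refine ⟨h.1, h.2.trans ?_⟩
    rw [Real.one_rpow, Real.zero_rpow (by positivity), Real.arcsin_one, Real.arcsin_zero]
    field_simp
    ring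
  · exact (continuous_const.mul (Real.continuous_arcsin.comp
      (Real.continuous_rpow_const (by positivity)))).continuousOn
  · obtain ⟨h0, h1⟩ := hs
    have hr0 : 0 < s ^ ((1 - p) / 2) := Real.rpow_pos_of_pos h0 _
    have hr1 : s ^ ((1 - p) / 2) < 1 := Real.rpow_lt_one h0.le h1 (by positivity)
    have hd := ((Real.hasDerivAt_arcsin (by linarith) hr1.ne).comp s
      (Real.hasDerivAt_rpow_const (p := (1 - p) / 2) (Or.inl h0.ne'))).const_mul (2 / (1 - p))
    refine hd.congr_deriv ?_
    have hy0 : 0 < s ^ ((p + 1) / 2) := Real.rpow_pos_of_pos h0 _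
    have e1 : s ^ ((1 - p) / 2 - 1) = (s ^ ((p + 1) / 2))⁻¹ := by
      rw [← Real.rpow_neg h0.le]; congr 1; ring
    have e2 : s ^ (p + 1) = (s ^ ((p + 1) / 2)) ^ 2 := by
      rw [← Real.rpow_natCast, ← Real.rpow_mul h0.le]; congr 1; push_cast; ring
    have e3 : s = s ^ ((p + 1) / 2) * s ^ ((1 - p) / 2) := by
      rw [← Real.rpow_add h0]; ring_nf; simp
    have e4 : (1 - s ^ 2) - 1 * (1 - s ^ (p + 1)) =
        (s ^ ((p + 1) / 2)) ^ 2 * (1 - (s ^ ((1 - p) / 2)) ^ 2) := by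
      rw [e2]
      nth_rewrite 1 [e3]
      ring
    rw [e4, Real.sqrt_mul (by positivity), Real.sqrt_sq hy0.le, e1]
    have : 0 < Real.sqrt (1 - (s ^ ((1 - p) / 2)) ^ 2) := Real.sqrt_pos.2 (by nlinarith)
    field_simp

lemma radicand_pos {p s : ℝ} (hp1 : p < 1) (hs : s ∈ Set.Ioo (0 : ℝ) 1) :
    0 < (1 - s ^ 2) - 1 * (1 - s ^ (p + 1)) := by
  have h := Real.rpow_lt_rpow_of_exponent_gt hs.1 hs.2 (show p + 1 < 2 by linarith)
  rw [Real.rpow_two] at h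
  linarith

lemma radicand_strictAnti {p s : ℝ} (hp0 : 0 < p) (hs : s ∈ Set.Ioo (0 : ℝ) 1) :
    StrictAnti fun k : ℝ => (1 - s ^ 2) - k * (1 - s ^ (p + 1)) := by
  intro k l hkl
  have h := Real.rpow_lt_one hs.1.le hs.2 (show 0 < p + 1 by linarith)
  have := mul_lt_mul_of_pos_right hkl (sub_pos.2 h)
  dsimp only
  linarith

lemma integrand_strictMonoOn {p s : ℝ} (hp0 : 0 < p) (hp1 : p < 1)
    (hs : s ∈ Set.Ioo (0 : ℝ) 1) :
    StrictMonoOn (fun k : ℝ => 1 / Real.sqrt ((1 - s ^ 2) - k * (1 - s ^ (p + 1))))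
      (Set.Iic 1) := by
  intro k _ l hl hkl
  have hl0 := (radicand_pos hp1 hs).trans_le ((radicand_strictAnti hp0 hs).antitone hl)
  exact one_div_lt_one_div_of_lt (Real.sqrt_pos.2 hl0)
    (Real.sqrt_lt_sqrt hl0.le (radicand_strictAnti hp0 hs hkl))

lemma aestronglyMeasurable_integrand (p k : ℝ) : AEStronglyMeasurable
    (fun s : ℝ => 1 / Real.sqrt ((1 - s ^ 2) - k * (1 - s ^ (p + 1))))
    (volume.restrict (Set.Ioo 0 1)) :=
  Measurable.aestronglyMeasurable (by fun_prop)

lemma ae_norm_integrand_le {p k : ℝ} (hp0 : 0 < p) (hp1 : p < 1) (hk : k ≤ 1) :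
    ∀ᵐ s : ℝ ∂volume.restrict (Set.Ioo 0 1),
      ‖1 / Real.sqrt ((1 - s ^ 2) - k * (1 - s ^ (p + 1)))‖ ≤
        1 / Real.sqrt ((1 - s ^ 2) - 1 * (1 - s ^ (p + 1))) := by
  filter_upwards [ae_restrict_mem measurableSet_Ioo] with s hs
  rw [Real.norm_of_nonneg (by positivity)]
  exact (integrand_strictMonoOn hp0 hp1 hs).monotoneOn hk (Set.mem_Iic.2 le_rfl) hk

lemma timeIntegral_strictMonoOn {p : ℝ} (hp0 : 0 < p) (hp1 : p < 1) :
    StrictMonoOn (timeIntegral p) (Set.Iic 1) := by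
  have hint : ∀ k ∈ Set.Iic (1 : ℝ), IntegrableOn
      (fun s : ℝ => 1 / Real.sqrt ((1 - s ^ 2) - k * (1 - s ^ (p + 1)))) (Set.Ioo 0 1) :=
    fun k hk => (timeIntegral_one hp1).1.mono' (aestronglyMeasurable_integrand p k)
      (ae_norm_integrand_le hp0 hp1 hk)
  intro k hk l hl hkl
  have hlt := fun s hs => integrand_strictMonoOn hp0 hp1 (s := s) hs hk hl hkl
  rw [timeIntegral, timeIntegral, ← sub_pos, ← integral_sub (hint l hl) (hint k hk)]
  refine (setIntegral_pos_iff_support_of_nonneg_ae ?_ ((hint l hl).sub (hint k hk))).2 ?_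
  · filter_upwards [ae_restrict_mem measurableSet_Ioo] with s hs
      using (sub_pos.2 (hlt s hs)).le
  · have hvol : 0 < volume (Set.Ioo (0 : ℝ) 1) := by simp
    exact hvol.trans_le (measure_mono fun s hs => ⟨(sub_pos.2 (hlt s hs)).ne', hs⟩)

lemma timeIntegral_continuousOn {p : ℝ} (hp0 : 0 < p) (hp1 : p < 1) :
    ContinuousOn (timeIntegral p) (Set.Iic 1) := by
  refine continuousOn_of_dominated (fun k _ => aestronglyMeasurable_integrand p k)
    (fun k hk => ae_norm_integrand_le hp0 hp1 hk) (timeIntegral_one hp1).1 ?_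
  filter_upwards [ae_restrict_mem measurableSet_Ioo] with s hs
  refine continuousOn_const.div (by fun_prop) fun k hk => (Real.sqrt_pos.2 ?_).ne'
  exact (radicand_pos hp1 hs).trans_le ((radicand_strictAnti hp0 hs).antitone hk)

lemma strictAntiOn_div_rpow {u q : ℝ} (hu : 0 < u) (hq : 0 < q) :
    StrictAntiOn (fun c : ℝ => (u / c) ^ q) (Set.Ioi 0) := fun _ hc _ hd hcd =>
  Real.rpow_lt_rpow (div_pos hu hd).le (div_lt_div_of_pos_left hu hc hcd) hq

theorem stmt11 (a p lam : ℝ) (ha : 0 < a) (hp0 : 0 < p) (hp1 : p < 1) (hlam : 0 < lam) :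
    ContinuousOn (Tmap a p lam) (Set.Ioi (uH a p lam)) ∧
    StrictAntiOn (Tmap a p lam) (Set.Ioi (uH a p lam)) ∧
    Filter.Tendsto (Tmap a p lam) Filter.atTop
      (nhds (Real.pi / (2 * Real.sqrt lam))) ∧
    Filter.Tendsto (Tmap a p lam) (nhdsWithin (uH a p lam) (Set.Ioi (uH a p lam)))
      (nhds (Real.pi / ((1 - p) * Real.sqrt lam))) := by
  have hu : 0 < uH a p lam := Real.rpow_pos_of_pos (by positivity) _
  have hq : 0 < 1 - p := by linarith
  have hT : Tmap a p lam = fun c =>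
      1 / Real.sqrt lam * timeIntegral p ((uH a p lam / c) ^ (1 - p)) := rfl
  have hl : 0 < 1 / Real.sqrt lam := by positivity
  rw [hT]
  generalize uH a p lam = u at hu ⊢
  have hmaps : Set.MapsTo (fun c : ℝ => (u / c) ^ (1 - p)) (Set.Ici u) (Set.Iic 1) :=
    fun c hc => Real.rpow_le_one (div_nonneg hu.le (hu.le.trans hc))
      ((div_le_one (hu.trans_le hc)).2 hc) hq.le
  have hcont : ContinuousOn
      (fun c => 1 / Real.sqrt lam * timeIntegral p ((u / c) ^ (1 - p))) (Set.Ici u) := by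
    refine continuousOn_const.mul ((timeIntegral_continuousOn hp0 hp1).comp ?_ hmaps)
    exact (continuousOn_const.div continuousOn_id fun c hc => (hu.trans_le hc).ne').rpow_const
      fun c hc => Or.inr hq.le
  refine ⟨hcont.mono Set.Ioi_subset_Ici_self, fun c hc d hd hcd => ?_, ?_, ?_⟩
  · exact mul_lt_mul_of_pos_left (timeIntegral_strictMonoOn hp0 hp1
      (hmaps (Set.mem_Ioi.1 hd).le) (hmaps (Set.mem_Ioi.1 hc).le)
      (strictAntiOn_div_rpow hu hq (hu.trans hc) (hu.trans hd) hcd)) hl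
  · have hk : Filter.Tendsto (fun c : ℝ => (u / c) ^ (1 - p)) Filter.atTop (nhds 0) := by
      have h := (Filter.Tendsto.const_div_atTop Filter.tendsto_id u).rpow_const
        (p := 1 - p) (Or.inr hq.le)
      simpa [Real.zero_rpow hq.ne'] using h
    have h0 := (timeIntegral_continuousOn hp0 hp1).continuousAt (Iic_mem_nhds zero_lt_one)
    have h := (h0.tendsto.comp hk).const_mul (1 / Real.sqrt lam)
    rw [timeIntegral_zero, ← mul_div_mul_comm, one_mul, mul_comm (Real.sqrt lam)] at h
    exact h
  · have h := (hcont u Set.self_mem_Ici).tendsto.mono_left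
      (nhdsWithin_mono u Set.Ioi_subset_Ici_self)
    rw [div_self hu.ne', Real.one_rpow, (timeIntegral_one hp1).2] at h
    convert h using 2
    field_simp
end

section
/- The function Ψ(ξ) := (2/L)²·(∫₀¹ ds/√((1−s²) − ξ^{1−p}·(1−s^{p+1})))² is well defined (the integral is finite) and strictly increasing on (0,1), Ψ(ξ) → (π/L)² as ξ → 0⁺, and Ψ(ξ) → (2/(1−p))²·(π/L)² as ξ → 1⁻. Consequently, for every λ with (π/L)² < λ < (2/(1−p))²·(π/L)² there exists a unique ξ ∈ (0,1) with Ψ(ξ) = λ. -/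
open MeasureTheory

/-- The function `Ψ(ξ)` of equation (3.25). -/
noncomputable def Psi (L p ξ : ℝ) : ℝ :=
  (2 / L) ^ 2 *
    (∫ s in Set.Ioo (0 : ℝ) 1,
      1 / Real.sqrt ((1 - s ^ 2) - ξ ^ (1 - p) * (1 - s ^ (p + 1)))) ^ 2

/-- The radicand in the definition of `Psi`, with `ξ ^ (1 - p)` replaced by a parameter `c`. -/
noncomputable def radicand (p c s : ℝ) : ℝ := (1 - s ^ 2) - c * (1 - s ^ (p + 1))

/-- The integral in the definition of `Psi`, with `ξ ^ (1 - p)` replaced by a parameter `c`. -/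
noncomputable def radicandIntegral (p c : ℝ) : ℝ :=
  ∫ s in Set.Ioo (0 : ℝ) 1, 1 / Real.sqrt (radicand p c s)

theorem Psi_eq (L p ξ : ℝ) :
    Psi L p ξ = (2 / L) ^ 2 * radicandIntegral p (ξ ^ (1 - p)) ^ 2 := rfl

theorem hasDerivAt_arcsin_rpow {q s : ℝ} (hq : 0 < q) (hs : s ∈ Set.Ioo (0 : ℝ) 1) :
    HasDerivAt (fun s : ℝ => Real.arcsin (s ^ q))
      (1 / Real.sqrt (1 - (s ^ q) ^ 2) * (q * s ^ (q - 1))) s := by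
  have h0 : 0 < s ^ q := Real.rpow_pos_of_pos hs.1 q
  have h1 : s ^ q < 1 := Real.rpow_lt_one hs.1.le hs.2 hq
  exact (Real.hasDerivAt_arcsin (by linarith) h1.ne).comp s
    (Real.hasDerivAt_rpow_const (Or.inl hs.1.ne'))

theorem continuous_arcsin_rpow {q : ℝ} (hq : 0 < q) :
    Continuous (fun s : ℝ => Real.arcsin (s ^ q)) :=
  Real.continuous_arcsin.comp (Real.continuous_rpow_const hq.le)

theorem integrableOn_deriv_arcsin_rpow {q : ℝ} (hq : 0 < q) :
    IntegrableOn (fun s : ℝ => 1 / Real.sqrt (1 - (s ^ q) ^ 2) * (q * s ^ (q - 1)))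
      (Set.Ioo 0 1) := by
  rw [← integrableOn_Ioc_iff_integrableOn_Ioo]
  refine intervalIntegral.integrableOn_deriv_of_nonneg
    (continuous_arcsin_rpow hq).continuousOn (fun s hs => hasDerivAt_arcsin_rpow hq hs) ?_
  intro s hs
  have := Real.rpow_nonneg hs.1.le (q - 1)
  positivity

theorem integral_deriv_arcsin_rpow {q : ℝ} (hq : 0 < q) :
    ∫ s in Set.Ioo (0 : ℝ) 1, 1 / Real.sqrt (1 - (s ^ q) ^ 2) * (q * s ^ (q - 1)) =
      Real.pi / 2 := by
  rw [← integral_Ioc_eq_integral_Ioo, ← intervalIntegral.integral_of_le zero_le_one,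
    intervalIntegral.integral_eq_sub_of_hasDerivAt_of_le zero_le_one
      (continuous_arcsin_rpow hq).continuousOn (fun s hs => hasDerivAt_arcsin_rpow hq hs)]
  · simp [hq.ne']
  · rw [intervalIntegrable_iff_integrableOn_Ioo_of_le zero_le_one]
    exact integrableOn_deriv_arcsin_rpow hq

theorem one_div_sqrt_radicand_one {p s : ℝ} (hp1 : p < 1) (hs : s ∈ Set.Ioo (0 : ℝ) 1) :
    1 / Real.sqrt (radicand p 1 s) =
      2 / (1 - p) * (1 / Real.sqrt (1 - (s ^ ((1 - p) / 2)) ^ 2) *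
        ((1 - p) / 2 * s ^ ((1 - p) / 2 - 1))) := by
  have hp : 1 - p ≠ 0 := by linarith
  have hfac : radicand p 1 s = (s ^ ((p + 1) / 2)) ^ 2 * (1 - (s ^ ((1 - p) / 2)) ^ 2) := by
    have h (a : ℝ) : (s ^ a) ^ 2 = s ^ (2 * a) := by
      rw [mul_comm, Real.rpow_mul hs.1.le]; simp
    rw [h, h, mul_sub, ← Real.rpow_add hs.1]
    have h2 : s ^ (2 * ((p + 1) / 2) + 2 * ((1 - p) / 2)) = s ^ 2 := by
      rw [← Real.rpow_natCast]; congr 1; push_cast; ring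
    rw [h2, radicand, show 2 * ((p + 1) / 2) = p + 1 by ring]
    ring
  have hneg : s ^ ((1 - p) / 2 - 1) = (s ^ ((p + 1) / 2))⁻¹ := by
    rw [← Real.rpow_neg hs.1.le]; congr 1; ring
  rw [hfac, Real.sqrt_mul (sq_nonneg _), Real.sqrt_sq (Real.rpow_nonneg hs.1.le _), hneg,
    one_div, mul_inv]
  field_simp

theorem integrableOn_radicand_one {p : ℝ} (hp1 : p < 1) :
    IntegrableOn (fun s : ℝ => 1 / Real.sqrt (radicand p 1 s)) (Set.Ioo 0 1) := by
  refine IntegrableOn.congr_fun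
    ((integrableOn_deriv_arcsin_rpow (q := (1 - p) / 2) (by linarith)).const_mul (2 / (1 - p)))
    (fun s hs => (one_div_sqrt_radicand_one hp1 hs).symm) measurableSet_Ioo

theorem radicandIntegral_one {p : ℝ} (hp1 : p < 1) :
    radicandIntegral p 1 = 2 / (1 - p) * (Real.pi / 2) := by
  rw [radicandIntegral, setIntegral_congr_fun measurableSet_Ioo
    (fun s hs => one_div_sqrt_radicand_one hp1 hs), integral_const_mul,
    integral_deriv_arcsin_rpow (by linarith)]

theorem radicandIntegral_zero (p : ℝ) : radicandIntegral p 0 = Real.pi / 2 := by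
  rw [← integral_deriv_arcsin_rpow one_pos]
  simp [radicandIntegral, radicand]

theorem radicand_one_pos {p s : ℝ} (hp1 : p < 1) (hs : s ∈ Set.Ioo (0 : ℝ) 1) :
    0 < radicand p 1 s := by
  have h : s ^ (2 : ℝ) < s ^ (p + 1) :=
    Real.rpow_lt_rpow_of_exponent_gt hs.1 hs.2 (by linarith)
  rw [Real.rpow_two] at h
  rw [radicand]
  linarith

theorem radicand_lt_radicand {p c d s : ℝ} (hp0 : 0 < p) (hs : s ∈ Set.Ioo (0 : ℝ) 1)
    (h : c < d) : radicand p d s < radicand p c s := by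
  have h1 : s ^ (p + 1) < 1 := Real.rpow_lt_one hs.1.le hs.2 (by linarith)
  have := mul_lt_mul_of_pos_right h (sub_pos.2 h1)
  rw [radicand, radicand]
  linarith

theorem radicand_pos_s12 {p c s : ℝ} (hp0 : 0 < p) (hp1 : p < 1) (hc : c ≤ 1)
    (hs : s ∈ Set.Ioo (0 : ℝ) 1) : 0 < radicand p c s := by
  rcases hc.eq_or_lt with rfl | hc
  · exact radicand_one_pos hp1 hs
  · exact (radicand_one_pos hp1 hs).trans (radicand_lt_radicand hp0 hs hc)

theorem one_div_sqrt_radicand_lt {p c d s : ℝ} (hp0 : 0 < p) (hp1 : p < 1) (h : c < d)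
    (hd : d ≤ 1) (hs : s ∈ Set.Ioo (0 : ℝ) 1) :
    1 / Real.sqrt (radicand p c s) < 1 / Real.sqrt (radicand p d s) := by
  have hpos := radicand_pos_s12 hp0 hp1 hd hs
  exact one_div_lt_one_div_of_lt (Real.sqrt_pos.2 hpos)
    (Real.sqrt_lt_sqrt hpos.le (radicand_lt_radicand hp0 hs h))

theorem norm_one_div_sqrt_radicand_le {p c s : ℝ} (hp0 : 0 < p) (hp1 : p < 1) (hc : c ≤ 1)
    (hs : s ∈ Set.Ioo (0 : ℝ) 1) :
    ‖1 / Real.sqrt (radicand p c s)‖ ≤ 1 / Real.sqrt (radicand p 1 s) := by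
  rw [Real.norm_of_nonneg (by positivity)]
  rcases hc.eq_or_lt with rfl | hc
  · exact le_rfl
  · exact (one_div_sqrt_radicand_lt hp0 hp1 hc le_rfl hs).le

theorem measurable_one_div_sqrt_radicand (p c : ℝ) :
    Measurable (fun s : ℝ => 1 / Real.sqrt (radicand p c s)) := by
  unfold radicand
  fun_prop

theorem integrableOn_radicand {p c : ℝ} (hp0 : 0 < p) (hp1 : p < 1) (hc : c ≤ 1) :
    IntegrableOn (fun s : ℝ => 1 / Real.sqrt (radicand p c s)) (Set.Ioo 0 1) :=
  Integrable.mono' (integrableOn_radicand_one hp1)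
    (measurable_one_div_sqrt_radicand p c).aestronglyMeasurable
    (ae_restrict_of_forall_mem measurableSet_Ioo
      fun _ hs => norm_one_div_sqrt_radicand_le hp0 hp1 hc hs)

theorem strictMonoOn_radicandIntegral {p : ℝ} (hp0 : 0 < p) (hp1 : p < 1) :
    StrictMonoOn (radicandIntegral p) (Set.Iic 1) := by
  intro c hc d hd h
  have hc' := integrableOn_radicand hp0 hp1 hc
  have hd' := integrableOn_radicand hp0 hp1 hd
  rw [← sub_pos, radicandIntegral, radicandIntegral, ← integral_sub hd' hc',
    ← integral_Ioc_eq_integral_Ioo, ← intervalIntegral.integral_of_le zero_le_one]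
  refine intervalIntegral.intervalIntegral_pos_of_pos_on ?_ (fun s hs => ?_) zero_lt_one
  · rw [intervalIntegrable_iff_integrableOn_Ioo_of_le zero_le_one]
    exact hd'.sub hc'
  · exact sub_pos.2 (one_div_sqrt_radicand_lt hp0 hp1 h hd hs)

theorem continuousOn_radicandIntegral {p : ℝ} (hp0 : 0 < p) (hp1 : p < 1) :
    ContinuousOn (radicandIntegral p) (Set.Iic 1) := by
  refine continuousOn_of_dominated
    (fun c _ => (measurable_one_div_sqrt_radicand p c).aestronglyMeasurable)
    (fun c hc => ae_restrict_of_forall_mem measurableSet_Ioo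
      fun s hs => norm_one_div_sqrt_radicand_le hp0 hp1 hc hs)
    (integrableOn_radicand_one hp1)
    (ae_restrict_of_forall_mem measurableSet_Ioo fun s hs => ?_)
  refine ContinuousOn.div continuousOn_const ?_
    fun c hc => (Real.sqrt_pos.2 (radicand_pos_s12 hp0 hp1 hc hs)).ne'
  unfold radicand
  fun_prop

theorem radicandIntegral_nonneg (p c : ℝ) : 0 ≤ radicandIntegral p c :=
  integral_nonneg fun _ => by positivity

theorem rpow_mem_Iic_one {p ξ : ℝ} (hp1 : p < 1) (hξ : ξ ∈ Set.Icc (0 : ℝ) 1) :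
    ξ ^ (1 - p) ∈ Set.Iic (1 : ℝ) :=
  Real.rpow_le_one hξ.1 hξ.2 (by linarith)

theorem strictMonoOn_Psi {L p : ℝ} (hL : 0 < L) (hp0 : 0 < p) (hp1 : p < 1) :
    StrictMonoOn (Psi L p) (Set.Icc 0 1) := by
  intro x hx y hy h
  rw [Psi_eq, Psi_eq]
  have hlt := strictMonoOn_radicandIntegral hp0 hp1 (rpow_mem_Iic_one hp1 hx)
    (rpow_mem_Iic_one hp1 hy) (Real.rpow_lt_rpow hx.1 h (by linarith))
  have := radicandIntegral_nonneg p (x ^ (1 - p))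
  gcongr

theorem continuousOn_Psi (L : ℝ) {p : ℝ} (hp0 : 0 < p) (hp1 : p < 1) :
    ContinuousOn (Psi L p) (Set.Icc 0 1) :=
  continuousOn_const.mul (((continuousOn_radicandIntegral hp0 hp1).comp
    (Real.continuous_rpow_const (by linarith)).continuousOn
    fun _ hx => rpow_mem_Iic_one hp1 hx).pow 2)

theorem Psi_zero (L : ℝ) {p : ℝ} (hp1 : p < 1) : Psi L p 0 = (Real.pi / L) ^ 2 := by
  rw [Psi_eq, Real.zero_rpow (by linarith), radicandIntegral_zero]
  ring

theorem Psi_one (L : ℝ) {p : ℝ} (hp1 : p < 1) :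
    Psi L p 1 = (2 / (1 - p)) ^ 2 * (Real.pi / L) ^ 2 := by
  rw [Psi_eq, Real.one_rpow, radicandIntegral_one hp1]
  ring

theorem stmt12 (L p : ℝ) (hL : 0 < L) (hp0 : 0 < p) (hp1 : p < 1) :
    (∀ ξ ∈ Set.Ioo (0 : ℝ) 1,
      IntegrableOn
        (fun s : ℝ => 1 / Real.sqrt ((1 - s ^ 2) - ξ ^ (1 - p) * (1 - s ^ (p + 1))))
        (Set.Ioo (0 : ℝ) 1)) ∧
    StrictMonoOn (Psi L p) (Set.Ioo (0 : ℝ) 1) ∧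
    Filter.Tendsto (Psi L p) (nhdsWithin 0 (Set.Ioi (0 : ℝ)))
      (nhds ((Real.pi / L) ^ 2)) ∧
    Filter.Tendsto (Psi L p) (nhdsWithin 1 (Set.Iio (1 : ℝ)))
      (nhds ((2 / (1 - p)) ^ 2 * (Real.pi / L) ^ 2)) ∧
    (∀ lam : ℝ, (Real.pi / L) ^ 2 < lam → lam < (2 / (1 - p)) ^ 2 * (Real.pi / L) ^ 2 →
      ∃! ξ : ℝ, ξ ∈ Set.Ioo (0 : ℝ) 1 ∧ Psi L p ξ = lam) := by
  have hmono := strictMonoOn_Psi hL hp0 hp1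
  have hcont := continuousOn_Psi L hp0 hp1
  refine ⟨fun ξ hξ => integrableOn_radicand hp0 hp1
      (rpow_mem_Iic_one hp1 (Set.Ioo_subset_Icc_self hξ)),
    hmono.mono Set.Ioo_subset_Icc_self, ?_, ?_, fun lam h0 h1 => ?_⟩
  · rw [← Psi_zero L hp1, ← nhdsWithin_Ioo_eq_nhdsGT zero_lt_one]
    exact (hcont 0 (by simp)).mono Set.Ioo_subset_Icc_self
  · rw [← Psi_one L hp1, ← nhdsWithin_Ioo_eq_nhdsLT zero_lt_one]
    exact (hcont 1 (by simp)).mono Set.Ioo_subset_Icc_self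
  · rw [← Psi_zero L hp1] at h0
    rw [← Psi_one L hp1] at h1
    obtain ⟨ξ, hξ, rfl⟩ := intermediate_value_Ioo zero_le_one hcont ⟨h0, h1⟩
    exact ⟨ξ, ⟨hξ, rfl⟩, fun η hη => hmono.injOn (Set.Ioo_subset_Icc_self hη.1)
      (Set.Ioo_subset_Icc_self hξ) hη.2⟩
end

section
/- Set L := 2·T_H(λ). For every doubly infinite sequence s = (s_i)_{i∈ℤ} with each s_i ∈ {0,1}, there exists a C² function u : ℝ → ℝ with u ≥ 0 satisfying u''(x) + λ·u(x) − a·u(x)^p = 0 for all x ∈ ℝ, such that: (a) u(iL) = u'(iL) = 0 for all i ∈ ℤ; (b) u ≡ 0 on ((i−1)L, iL) if s_i = 0, while u(x) > 0 for all x ∈ ((i−1)L, iL) and the supremum of u over that interval equals u_H(λ) if s_i = 1; (c) if s is periodic with period κ, then u(x + κL) = u(x) for all x ∈ ℝ. -/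
/-- The extinction time `T_H(λ) = π/((1-p)·√λ)`. -/
noncomputable def TH (p lam : ℝ) : ℝ := Real.pi / ((1 - p) * Real.sqrt lam)

open Filter Topology

theorem hasDerivAt_abs_rpow_mul_self {q : ℝ} (hq : 0 < q) (t : ℝ) :
    HasDerivAt (fun t : ℝ => |t| ^ q * t) ((q + 1) * |t| ^ q) t := by
  rcases eq_or_ne t 0 with rfl | ht
  · rw [hasDerivAt_iff_tendsto_slope]
    have hc : Tendsto (fun t : ℝ => |t| ^ q) (𝓝[≠] 0) (𝓝 (|(0 : ℝ)| ^ q)) :=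
      ((continuous_abs.rpow_const fun _ => Or.inr hq.le).tendsto 0).mono_left nhdsWithin_le_nhds
    have h0 : (q + 1) * |(0 : ℝ)| ^ q = |(0 : ℝ)| ^ q := by
      simp [Real.zero_rpow hq.ne']
    rw [h0]
    refine hc.congr' ?_
    filter_upwards [self_mem_nhdsWithin] with y hy
    have hy' : y ≠ 0 := hy
    simp [slope_def_field, hy']
  · have h := ((hasDerivAt_abs ht).rpow_const (p := q) (Or.inl (abs_ne_zero.2 ht))).mul
      (hasDerivAt_id t)
    refine h.congr_deriv ?_
    have h1 : (SignType.sign t : ℝ) * t = |t| := sign_mul_self t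
    have h2 : |t| ^ (q - 1) * |t| = |t| ^ q := by
      rw [← Real.rpow_add_one (abs_ne_zero.2 ht), sub_add_cancel]
    simp only [id]
    linear_combination q * h2 + q * |t| ^ (q - 1) * h1

theorem eventually_ceil_eq {y : ℝ} (hy : ∀ n : ℤ, y ≠ n) : ∀ᶠ z in 𝓝 y, ⌈z⌉ = ⌈y⌉ := by
  have h1 : (⌈y⌉ : ℝ) - 1 < y := by linarith [Int.ceil_lt_add_one y]
  have h2 : y < ⌈y⌉ := lt_of_le_of_ne (Int.le_ceil y) (hy _)
  filter_upwards [Ioo_mem_nhds h1 h2] with z hz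
  exact Int.ceil_eq_iff.2 ⟨hz.1, hz.2.le⟩

/-- The function equal to `g` on the cells `((i - 1) * L, i * L]` with `s i = 1`,
and to zero on the other cells. -/
noncomputable def cellRestrict (s : ℤ → Fin 2) (L : ℝ) (g : ℝ → ℝ) (x : ℝ) : ℝ :=
  if s ⌈x / L⌉ = 1 then g x else 0

theorem abs_cellRestrict_le (s : ℤ → Fin 2) (L : ℝ) (g : ℝ → ℝ) (x : ℝ) :
    |cellRestrict s L g x| ≤ |g x| := by
  unfold cellRestrict
  split_ifs <;> simp

theorem cellRestrict_eq_zero {s : ℤ → Fin 2} {L : ℝ} {g : ℝ → ℝ} {x : ℝ} (h : g x = 0) :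
    cellRestrict s L g x = 0 := by
  simp [cellRestrict, h]

theorem ceil_div_eq {L x : ℝ} (hL : 0 < L) {i : ℤ}
    (hx : x ∈ Set.Ioo (((i : ℝ) - 1) * L) (i * L)) : ⌈x / L⌉ = i :=
  Int.ceil_eq_iff.2 ⟨(lt_div_iff₀ hL).2 hx.1, ((div_lt_iff₀ hL).2 hx.2).le⟩

theorem eventually_ceil_div_eq {L x : ℝ} (hL : 0 < L) (hx : ∀ n : ℤ, x ≠ n * L) :
    ∀ᶠ y in 𝓝 x, ⌈y / L⌉ = ⌈x / L⌉ :=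
  (continuous_id.div_const L).continuousAt.eventually
    (eventually_ceil_eq fun n h => hx n ((div_eq_iff hL.ne').1 h))

theorem continuous_cellRestrict (s : ℤ → Fin 2) {L : ℝ} (hL : 0 < L) {g : ℝ → ℝ}
    (hg : Continuous g) (h0 : ∀ n : ℤ, g (n * L) = 0) : Continuous (cellRestrict s L g) := by
  refine continuous_iff_continuousAt.2 fun x => ?_
  by_cases hx : ∃ n : ℤ, x = n * L
  · obtain ⟨n, rfl⟩ := hx
    rw [ContinuousAt, cellRestrict_eq_zero (h0 n)]
    refine squeeze_zero_norm (abs_cellRestrict_le s L g) ?_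
    simpa [h0 n] using (hg.abs.tendsto (n * L))
  · push Not at hx
    by_cases hs : s ⌈x / L⌉ = 1
    · refine hg.continuousAt.congr ?_
      filter_upwards [eventually_ceil_div_eq hL hx] with y hy
      simp [cellRestrict, hy, hs]
    · refine (continuousAt_const (y := (0 : ℝ))).congr ?_
      filter_upwards [eventually_ceil_div_eq hL hx] with y hy
      simp [cellRestrict, hy, hs]

theorem hasDerivAt_cellRestrict (s : ℤ → Fin 2) {L : ℝ} (hL : 0 < L) {g g' : ℝ → ℝ}
    (hg : ∀ x, HasDerivAt g (g' x) x) (h0 : ∀ n : ℤ, g (n * L) = 0)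
    (h0' : ∀ n : ℤ, g' (n * L) = 0) (x : ℝ) :
    HasDerivAt (cellRestrict s L g) (cellRestrict s L g' x) x := by
  by_cases hx : ∃ n : ℤ, x = n * L
  · obtain ⟨n, rfl⟩ := hx
    have h := hg (n * L)
    rw [h0' n, hasDerivAt_iff_isLittleO] at h
    rw [cellRestrict_eq_zero (h0' n), hasDerivAt_iff_isLittleO, cellRestrict_eq_zero (h0 n)]
    simp only [h0 n, smul_zero, sub_zero] at h ⊢
    exact (Asymptotics.isBigO_of_le _ (abs_cellRestrict_le s L g)).trans_isLittleO h
  · push Not at hx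
    by_cases hs : s ⌈x / L⌉ = 1
    · have : cellRestrict s L g' x = g' x := by simp [cellRestrict, hs]
      rw [this]
      refine (hg x).congr_of_eventuallyEq ?_
      filter_upwards [eventually_ceil_div_eq hL hx] with y hy
      simp [cellRestrict, hy, hs]
    · have : cellRestrict s L g' x = 0 := by simp [cellRestrict, hs]
      rw [this]
      refine (hasDerivAt_const x (0 : ℝ)).congr_of_eventuallyEq ?_
      filter_upwards [eventually_ceil_div_eq hL hx] with y hy
      simp [cellRestrict, hy, hs]

theorem contDiff_two_of_hasDerivAt {u u' u'' : ℝ → ℝ} (h : ∀ x, HasDerivAt u (u' x) x)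
    (h' : ∀ x, HasDerivAt u' (u'' x) x) (hc : Continuous u'') : ContDiff ℝ 2 u := by
  have e : deriv u = u' := funext fun x => (h x).deriv
  have e' : deriv u' = u'' := funext fun x => (h' x).deriv
  rw [show (2 : WithTop ℕ∞) = 1 + 1 by norm_num, contDiff_succ_iff_deriv]
  refine ⟨fun x => (h x).differentiableAt, by simp, ?_⟩
  rw [e, contDiff_one_iff_deriv, e']
  exact ⟨fun x => (h' x).differentiableAt, hc⟩

theorem uH_pos {a p lam : ℝ} (ha : 0 < a) (hp0 : 0 < p) (hlam : 0 < lam) :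
    0 < uH a p lam :=
  Real.rpow_pos_of_pos (by positivity) _

theorem mul_uH_rpow {a p lam : ℝ} (ha : 0 < a) (hp0 : 0 < p) (hp1 : p < 1) (hlam : 0 < lam) :
    a * uH a p lam ^ p = (p + 1) * lam / 2 * uH a p lam := by
  have hU := uH_pos ha hp0 hlam
  have h1 : uH a p lam ^ (1 - p) = 2 * a / ((p + 1) * lam) := by
    rw [uH, ← Real.rpow_mul (by positivity), one_div_mul_cancel (by linarith), Real.rpow_one]
  have h2 : uH a p lam = uH a p lam ^ p * uH a p lam ^ (1 - p) := by
    rw [← Real.rpow_add hU, add_sub_cancel, Real.rpow_one]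
  rw [h1] at h2
  have : 0 < p + 1 := by linarith
  generalize uH a p lam ^ p = V at *
  rw [h2]
  field_simp

theorem stmt14 (a p lam : ℝ) (ha : 0 < a) (hp0 : 0 < p) (hp1 : p < 1) (hlam : 0 < lam)
    (s : ℤ → Fin 2) :
    ∃ u : ℝ → ℝ,
      ContDiff ℝ 2 u ∧
      (∀ x : ℝ, 0 ≤ u x) ∧
      (∀ x : ℝ, deriv (deriv u) x + lam * u x - a * u x ^ p = 0) ∧
      (∀ i : ℤ, u ((i : ℝ) * (2 * TH p lam)) = 0 ∧
        deriv u ((i : ℝ) * (2 * TH p lam)) = 0) ∧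
      (∀ i : ℤ, s i = 0 →
        ∀ x ∈ Set.Ioo (((i : ℝ) - 1) * (2 * TH p lam)) ((i : ℝ) * (2 * TH p lam)),
          u x = 0) ∧
      (∀ i : ℤ, s i = 1 →
        (∀ x ∈ Set.Ioo (((i : ℝ) - 1) * (2 * TH p lam)) ((i : ℝ) * (2 * TH p lam)),
          0 < u x) ∧
        sSup (u '' Set.Ioo (((i : ℝ) - 1) * (2 * TH p lam)) ((i : ℝ) * (2 * TH p lam)))
          = uH a p lam) ∧
      (∀ κ : ℕ, 0 < κ → (∀ i : ℤ, s (i + (κ : ℤ)) = s i) →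
        ∀ x : ℝ, u (x + (κ : ℝ) * (2 * TH p lam)) = u x) := by
  set L := 2 * TH p lam with hLdef
  set U := uH a p lam with hUdef
  have hU : 0 < U := uH_pos ha hp0 hlam
  have hp : 0 < 1 - p := by linarith
  have hsq : 0 < Real.sqrt lam := Real.sqrt_pos.2 hlam
  have hL : 0 < L := by
    have := Real.pi_pos
    rw [hLdef, TH]
    positivity
  obtain ⟨w, hw⟩ : ∃ w, w = (1 - p) * Real.sqrt lam / 2 := ⟨_, rfl⟩
  have hwL : w * L = Real.pi := by
    rw [hw, hLdef, TH]
    field_simp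
  have hw0 : 0 < w := by rw [hw]; positivity
  obtain ⟨q, hq⟩ : ∃ q, q = 2 * p / (1 - p) := ⟨_, rfl⟩
  have hq0 : 0 < q := by rw [hq]; positivity
  have hqp : q * (1 - p) = 2 * p := by rw [hq]; field_simp
  have hq2 : (q + 2) * p = q := by linear_combination -hqp
  have hqw : (q + 2) ^ 2 * w ^ 2 = lam := by
    have h1 : (q + 2) * (1 - p) = 2 := by linear_combination hqp
    have h2 : Real.sqrt lam ^ 2 = lam := Real.sq_sqrt hlam.le
    have h3 : (q + 2) * w = Real.sqrt lam := by
      rw [hw]; linear_combination Real.sqrt lam / 2 * h1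
    rw [← mul_pow, h3, h2]
  have hUp : a * U ^ p = (q + 2) * (q + 1) * w ^ 2 * U := by
    rw [hUdef, mul_uH_rpow ha hp0 hp1 hlam, ← hUdef]
    linear_combination (q + 2) * w ^ 2 * U / 2 * hq2 - (p + 1) / 2 * U * hqw
  have hsin : ∀ n : ℤ, Real.sin (w * (n * L)) = 0 := fun n => by
    rw [show w * (n * L) = n * Real.pi by rw [← hwL]; ring]
    exact Real.sin_int_mul_pi n
  have hsplit : ∀ t : ℝ, |t| ^ (q + 2) = |t| ^ q * t ^ 2 := fun t => by
    rw [← sq_abs t, ← Real.rpow_natCast |t| 2,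
      ← Real.rpow_add_of_nonneg (abs_nonneg t) hq0.le (by norm_num)]
    norm_num
  let f : ℝ → ℝ := fun x => U * |Real.sin (w * x)| ^ (q + 2)
  let f' : ℝ → ℝ := fun x =>
    U * (q + 2) * w * (|Real.sin (w * x)| ^ q * Real.sin (w * x) * Real.cos (w * x))
  let f'' : ℝ → ℝ := fun x => U * (q + 2) * w * (((q + 1) * |Real.sin (w * x)| ^ q *
    Real.cos (w * x) ^ 2 - |Real.sin (w * x)| ^ q * Real.sin (w * x) ^ 2) * w)
  have hlin : ∀ x : ℝ, HasDerivAt (fun x => w * x) w x := fun x => by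
    simpa using (hasDerivAt_id x).const_mul w
  have hf : ∀ x, HasDerivAt f (f' x) x := fun x => by
    have h := ((hasDerivAt_abs_rpow (Real.sin (w * x)) (p := q + 2) (by linarith)).comp x
      (hlin x).sin).const_mul U
    refine h.congr_deriv ?_
    simp only [f', add_sub_cancel_right]
    ring
  have hf' : ∀ x, HasDerivAt f' (f'' x) x := fun x => by
    have h := (((hasDerivAt_abs_rpow_mul_self hq0 (Real.sin (w * x))).comp x
      (hlin x).sin).mul (hlin x).cos).const_mul (U * (q + 2) * w)
    refine h.congr_deriv ?_
    simp only [f'', Function.comp]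
    ring
  have hf'' : Continuous f'' := by
    have hc : Continuous fun x => |Real.sin (w * x)| ^ q :=
      Continuous.rpow_const (by fun_prop) fun _ => Or.inr hq0.le
    fun_prop
  have z : ∀ n : ℤ, f (n * L) = 0 := fun n => by
    simp [f, hsin n, Real.zero_rpow (by linarith : q + 2 ≠ 0)]
  have z' : ∀ n : ℤ, f' (n * L) = 0 := fun n => by simp [f', hsin n]
  have z'' : ∀ n : ℤ, f'' (n * L) = 0 := fun n => by
    simp [f'', hsin n, Real.zero_rpow hq0.ne']
  have hode : ∀ x, f'' x + lam * f x - a * f x ^ p = 0 := fun x => by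
    have hpow : f x ^ p = U ^ p * |Real.sin (w * x)| ^ q := by
      simp only [f]
      rw [Real.mul_rpow hU.le (by positivity), ← Real.rpow_mul (abs_nonneg _), hq2]
    rw [hpow, ← mul_assoc a, hUp, ← hqw]
    simp only [f, f'', hsplit, Real.cos_sq']
    ring
  have hpos : ∀ i : ℤ, ∀ x ∈ Set.Ioo (((i : ℝ) - 1) * L) (i * L), 0 < f x := by
    intro i x hx
    have hne : Real.sin (w * x) ≠ 0 := fun h => by
      obtain ⟨n, hn⟩ := Real.sin_eq_zero_iff.1 h
      have hx' : x = n * L := by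
        rw [← hwL] at hn
        exact mul_left_cancel₀ hw0.ne' (by linear_combination -hn)
      rw [hx'] at hx
      have h1 : ((i - 1 : ℤ) : ℝ) < n := by
        push_cast
        exact lt_of_mul_lt_mul_right hx.1 hL.le
      have h2 : (n : ℝ) < i := lt_of_mul_lt_mul_right hx.2 hL.le
      have h1' := Int.cast_lt.1 h1
      have h2' := Int.cast_lt.1 h2
      omega
    exact mul_pos hU (Real.rpow_pos_of_pos (abs_pos.2 hne) _)
  have hle : ∀ x, f x ≤ U := fun x =>
    mul_le_of_le_one_right hU.le
      (Real.rpow_le_one (abs_nonneg _) (Real.abs_sin_le_one _) (by linarith))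
  have hmid : ∀ i : ℤ, f ((i - 1 / 2) * L) = U := fun i => by
    have h : w * ((i - 1 / 2) * L) = i * Real.pi - Real.pi / 2 := by rw [← hwL]; ring
    simp only [f]
    rw [h, Real.sin_sub_pi_div_two, abs_neg, Real.abs_cos_int_mul_pi, Real.one_rpow, mul_one]
  have hu := hasDerivAt_cellRestrict s hL hf z z'
  have hu' := hasDerivAt_cellRestrict s hL hf' z' z''
  have e : deriv (cellRestrict s L f) = cellRestrict s L f' := funext fun x => (hu x).deriv
  have e' : deriv (cellRestrict s L f') = cellRestrict s L f'' := funext fun x => (hu' x).deriv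
  refine ⟨cellRestrict s L f,
    contDiff_two_of_hasDerivAt hu hu' (continuous_cellRestrict s hL hf'' z''),
    fun x => ?_, fun x => ?_, fun i => ⟨cellRestrict_eq_zero (z i), ?_⟩, fun i hi x hx => ?_,
    fun i hi => ?_, fun κ _ hs x => ?_⟩
  · unfold cellRestrict
    split_ifs
    · positivity
    · exact le_rfl
  · rw [e, e']
    unfold cellRestrict
    split_ifs
    · exact hode x
    · simp [Real.zero_rpow hp0.ne']
  · rw [e]
    exact cellRestrict_eq_zero (z' i)
  · simp [cellRestrict, ceil_div_eq hL hx, hi]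
  · have heq : Set.EqOn (cellRestrict s L f) f (Set.Ioo (((i : ℝ) - 1) * L) (i * L)) :=
      fun x hx => by simp [cellRestrict, ceil_div_eq hL hx, hi]
    refine ⟨fun x hx => (heq hx).symm ▸ hpos i x hx, ?_⟩
    rw [heq.image_eq]
    refine IsGreatest.csSup_eq ⟨⟨(i - 1 / 2) * L, ⟨?_, ?_⟩, hmid i⟩, ?_⟩
    · exact mul_lt_mul_of_pos_right (by linarith) hL
    · exact mul_lt_mul_of_pos_right (by linarith) hL
    · rintro _ ⟨x, -, rfl⟩
      exact hle x
  · have h1 : ⌈(x + κ * L) / L⌉ = ⌈x / L⌉ + (κ : ℤ) := by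
      rw [add_div, mul_div_cancel_right₀ _ hL.ne', Int.ceil_add_natCast]
    have h2 : f (x + κ * L) = f x := by
      have h : w * (x + κ * L) = w * x + κ * Real.pi := by rw [← hwL]; ring
      simp only [f]
      rw [h, Real.sin_add_nat_mul_pi, abs_mul, abs_pow, abs_neg, abs_one, one_pow, one_mul]
    unfold cellRestrict
    rw [h1, hs, h2]
end

section
/- If 0 < λ ≤ (π/L)², then the only nonnegative solution of the BVP is the identically zero function. -/
/-- A nonnegative solution of the boundary value problem
`u'' + λu - a u^p = 0` in `[0,L]`, `u(0) = u(L) = 0`. -/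
def IsNonnegSolution (a L p lam : ℝ) (u : ℝ → ℝ) : Prop :=
  ContDiffOn ℝ 2 u (Set.Icc 0 L) ∧
  (∀ x ∈ Set.Icc (0 : ℝ) L, 0 ≤ u x) ∧
  u 0 = 0 ∧ u L = 0 ∧
  ∀ x ∈ Set.Icc (0 : ℝ) L,
    iteratedDerivWithin 2 u (Set.Icc 0 L) x + lam * u x - a * u x ^ p = 0

theorem stmt17 (a L p lam : ℝ) (ha : 0 < a) (hL : 0 < L) (hp0 : 0 < p) (hp1 : p < 1)
    (hlam0 : 0 < lam) (hlam : lam ≤ (Real.pi / L) ^ 2)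
    (u : ℝ → ℝ) (hu : IsNonnegSolution a L p lam u) :
    ∀ x ∈ Set.Icc (0 : ℝ) L, u x = 0 := by
  obtain ⟨hC, hpos, hu0, huL, hode⟩ := hu
  set k := Real.pi / L with hk
  have hkL : k * L = Real.pi := by rw [hk]; field_simp
  have hk0 : 0 < k := div_pos Real.pi_pos hL
  set v := derivWithin u (Set.Icc 0 L) with hv
  have huniq : UniqueDiffOn ℝ (Set.Icc 0 L) := uniqueDiffOn_Icc hL
  have hdu : ∀ x ∈ Set.Icc 0 L, HasDerivWithinAt u (v x) (Set.Icc 0 L) x := fun x hx =>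
    (hC.differentiableOn (by norm_num) x hx).hasDerivWithinAt
  have hdv : ∀ x ∈ Set.Icc 0 L,
      HasDerivWithinAt v (a * u x ^ p - lam * u x) (Set.Icc 0 L) x := by
    intro x hx
    have hvC : ContDiffOn ℝ 1 v (Set.Icc 0 L) := hC.derivWithin huniq (by norm_num)
    have h := (hvC.differentiableOn (by norm_num) x hx).hasDerivWithinAt
    have h2 := hode x hx
    rw [iteratedDerivWithin_succ', iteratedDerivWithin_one, ← hv] at h2
    exact h.congr_deriv (by linarith)
  -- The Wronskian of `u` with the first Dirichlet eigenfunction.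
  set W : ℝ → ℝ := fun x => v x * Real.sin (k * x) - u x * (k * Real.cos (k * x)) with hW
  have hdW : ∀ x ∈ Set.Icc 0 L, HasDerivWithinAt W
      (((k ^ 2 - lam) * u x + a * u x ^ p) * Real.sin (k * x)) (Set.Icc 0 L) x := by
    intro x hx
    have hlin : HasDerivAt (fun y : ℝ => k * y) k x := by
      simpa using (hasDerivAt_id x).const_mul k
    have h := ((hdv x hx).mul hlin.sin.hasDerivWithinAt).sub
      ((hdu x hx).mul (hlin.cos.const_mul k).hasDerivWithinAt)
    exact h.congr_deriv (by ring)
  have hsin : ∀ x ∈ Set.Ioo 0 L, 0 < Real.sin (k * x) := fun x hx =>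
    Real.sin_pos_of_pos_of_lt_pi (mul_pos hk0 hx.1)
      (hkL ▸ mul_lt_mul_of_pos_left hx.2 hk0)
  have hmono : MonotoneOn W (Set.Icc 0 L) := by
    refine monotoneOn_of_hasDerivWithinAt_nonneg (convex_Icc 0 L)
      (fun x hx => (hdW x hx).continuousWithinAt)
      (fun x hx => (hdW x (interior_subset hx)).mono interior_subset) fun x hx => ?_
    have hux := hpos x (interior_subset hx)
    rw [interior_Icc] at hx
    exact mul_nonneg (add_nonneg (mul_nonneg (sub_nonneg.2 hlam) hux)
      (mul_nonneg ha.le (Real.rpow_nonneg hux p))) (hsin x hx).le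
  have hWzero : ∀ x ∈ Set.Icc 0 L, W x = 0 := by
    intro x hx
    have h0 : W 0 = 0 := by simp [hW, hu0]
    have h1 : W L = 0 := by simp [hW, huL, hkL]
    exact le_antisymm (h1 ▸ hmono hx (Set.right_mem_Icc.2 hL.le) hx.2)
      (h0 ▸ hmono (Set.left_mem_Icc.2 hL.le) hx hx.1)
  intro x hx
  rcases hx.1.eq_or_lt with rfl | hx0
  · exact hu0
  rcases hx.2.eq_or_lt with rfl | hxL
  · exact huL
  have hzero : HasDerivWithinAt W 0 (Set.Icc 0 L) x :=
    (hasDerivWithinAt_const x _ (0 : ℝ)).congr hWzero (hWzero x hx)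
  have hprod := (huniq x hx).eq_deriv _ (hdW x hx) hzero
  by_contra hne
  have hux : 0 < u x := lt_of_le_of_ne (hpos x hx) (Ne.symm hne)
  have h1 := mul_nonneg (sub_nonneg.2 hlam) hux.le
  have h2 := mul_pos ha (Real.rpow_pos_of_pos hux p)
  exact (mul_pos (add_pos_of_nonneg_of_pos h1 h2) (hsin x ⟨hx0, hxL⟩)).ne' hprod
end

section
/- Let u be a nonzero nonnegative solution of the BVP. Then exactly one of the following holds: (i) u is a classical positive solution, in which case (π/L)² < λ < (2/(1−p))²·(π/L)²; or (ii) there exist an integer j ≥ 1 and points 0 < x₁ < ⋯ < x_j < L with x₁ ≥ T_H(λ), x_i − x_{i−1} ≥ 2·T_H(λ) for 2 ≤ i ≤ j, and x_j ≤ L − T_H(λ), such that u(x) = Σ_{i=1}^{j} û_λ(x − x_i) for all x ∈ [0,L]. -/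
/-- The degenerate homoclinic solution `û_λ`. -/
noncomputable def uhat (a p lam x : ℝ) : ℝ :=
  if |x| ≤ TH p lam then
    uH a p lam * Real.cos ((1 - p) * Real.sqrt lam * x / 2) ^ (2 / (1 - p))
  else 0

/-- A classical positive solution: positive in `(0,L)`, `u'(0) > 0` and `u'(L) < 0`. -/
def IsClassicalPositiveSolution (a L p lam : ℝ) (u : ℝ → ℝ) : Prop :=
  IsNonnegSolution a L p lam u ∧
  (∀ x ∈ Set.Ioo (0 : ℝ) L, 0 < u x) ∧
  0 < derivWithin u (Set.Icc 0 L) 0 ∧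
  derivWithin u (Set.Icc 0 L) L < 0

/-- Admissibility of the bump locations `0 < x₁ < ⋯ < x_j < L` with
`x₁ ≥ T_H(λ)`, `x_i - x_{i-1} ≥ 2 T_H(λ)` and `x_j ≤ L - T_H(λ)`. -/
def AdmissibleBumps (L p lam : ℝ) (j : ℕ) (hj : 0 < j) (x : Fin j → ℝ) : Prop :=
  StrictMono x ∧ (∀ i, 0 < x i ∧ x i < L) ∧
  TH p lam ≤ x ⟨0, hj⟩ ∧
  (∀ i : Fin j, ∀ hi : (i : ℕ) + 1 < j, 2 * TH p lam ≤ x ⟨(i : ℕ) + 1, hi⟩ - x i) ∧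
  x ⟨j - 1, Nat.sub_lt hj Nat.one_pos⟩ ≤ L - TH p lam

open Set

/-- A nonnegative `u` with `u 0 = u L = 0` solving `u' = v`, `v' = a u^p - λ u` on `[0, L]`. -/
structure IsPhaseSolution (a L p lam : ℝ) (u v : ℝ → ℝ) : Prop where
  nonneg : ∀ x ∈ Icc 0 L, 0 ≤ u x
  left : u 0 = 0
  right : u L = 0
  deriv_fst : ∀ x ∈ Icc 0 L, HasDerivWithinAt u (v x) (Icc 0 L) x
  deriv_snd : ∀ x ∈ Icc 0 L, HasDerivWithinAt v (a * u x ^ p - lam * u x) (Icc 0 L) x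

lemma IsNonnegSolution.isPhaseSolution {a L p lam : ℝ} {u : ℝ → ℝ} (hL : 0 < L)
    (hu : IsNonnegSolution a L p lam u) :
    IsPhaseSolution a L p lam u (derivWithin u (Icc 0 L)) := by
  obtain ⟨hc, h0, hl, hr, he⟩ := hu
  have hud : UniqueDiffOn ℝ (Icc 0 L) := uniqueDiffOn_Icc hL
  refine ⟨h0, hl, hr, fun x hx => ((hc.differentiableOn (by norm_num)) x hx).hasDerivWithinAt, ?_⟩
  intro x hx
  have hd : DifferentiableOn ℝ (iteratedDerivWithin 1 u (Icc 0 L)) (Icc 0 L) :=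
    hc.differentiableOn_iteratedDerivWithin (by norm_num) hud
  have h1 : iteratedDerivWithin 1 u (Icc 0 L) = derivWithin u (Icc 0 L) := by
    funext y
    rw [iteratedDerivWithin_one]
  have h2 := he x hx
  rw [iteratedDerivWithin_succ, h1] at h2
  rw [h1] at hd
  exact (hd x hx).hasDerivWithinAt.congr_deriv (by linarith)

/-- The conserved energy. -/
noncomputable def energy (a p lam s t : ℝ) : ℝ :=
  t ^ 2 / 2 + lam * s ^ 2 / 2 - a * s ^ (p + 1) / (p + 1)

/-- A harmonic oscillation that is at rest at `c` is a cosine centred at `c`. -/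
lemma eq_cos_of_oscillator {w z : ℝ → ℝ} {α β c ω : ℝ} (hω : ω ≠ 0) (hc : c ∈ Ioo α β)
    (hw : ∀ x ∈ Ioo α β, HasDerivAt w (z x) x)
    (hz : ∀ x ∈ Ioo α β, HasDerivAt z (-ω ^ 2 * w x) x) (hzc : z c = 0)
    {x : ℝ} (hx : x ∈ Ioo α β) : w x = w c * Real.cos (ω * (x - c)) := by
  set g : ℝ → ℝ := fun x => ω ^ 2 * (w x - w c * Real.cos (ω * (x - c))) ^ 2 +
    (z x + w c * ω * Real.sin (ω * (x - c))) ^ 2 with hg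
  have hgd : ∀ x ∈ Ioo α β, HasDerivAt g 0 x := by
    intro x hx
    have hl : HasDerivAt (fun x => ω * (x - c)) ω x := by
      simpa using ((hasDerivAt_id x).sub_const c).const_mul ω
    have h1 := (((hw x hx).sub ((hl.cos).const_mul (w c))).pow 2).const_mul (ω ^ 2)
    have h2 := (((hz x hx).add ((hl.sin).const_mul (w c * ω))).pow 2)
    refine (h1.add h2).congr_deriv ?_
    simp
    ring
  have hgc : g x = g c := by
    refine isOpen_Ioo.is_const_of_deriv_eq_zero isPreconnected_Ioo
      (fun y hy => (hgd y hy).differentiableAt.differentiableWithinAt)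
      (fun y hy => (hgd y hy).deriv) hx hc
  have h0 : g c = 0 := by simp [hg, hzc]
  rw [h0] at hgc
  have h1 : ω ^ 2 * (w x - w c * Real.cos (ω * (x - c))) ^ 2 = 0 := by
    have := sq_nonneg (z x + w c * ω * Real.sin (ω * (x - c)))
    have h3 : 0 ≤ ω ^ 2 * (w x - w c * Real.cos (ω * (x - c))) ^ 2 := by positivity
    simp only [hg] at hgc
    linarith
  have h2 : w x - w c * Real.cos (ω * (x - c)) = 0 := by simpa [hω] using h1
  linarith

lemma exists_neg_of_hasDerivWithinAt_left {f : ℝ → ℝ} {m L d : ℝ}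
    (hf : HasDerivWithinAt f m (Icc 0 L) 0) (h0 : f 0 = 0) (hm : m < 0) (hd : 0 < d)
    (hdL : d ≤ L) : ∃ x ∈ Ioo 0 d, f x < 0 := by
  have h1 : HasDerivWithinAt f m (Ioo 0 d) 0 :=
    hf.mono (fun x hx => ⟨hx.1.le, hx.2.le.trans hdL⟩)
  rw [hasDerivWithinAt_iff_tendsto_slope' (by simp)] at h1
  have h2 := h1.eventually_lt_const hm
  have : (nhdsWithin (0 : ℝ) (Ioo 0 d)).NeBot := left_nhdsWithin_Ioo_neBot hd
  obtain ⟨x, hx, hx'⟩ := (h2.and self_mem_nhdsWithin).exists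
  refine ⟨x, hx', ?_⟩
  rw [slope_def_field, h0, sub_zero, sub_zero, div_lt_iff₀ hx'.1] at hx
  linarith

lemma exists_pos_of_hasDerivWithinAt_right {f : ℝ → ℝ} {m L : ℝ} (hL : 0 < L)
    (hf : HasDerivWithinAt f m (Icc 0 L) L) (h0 : f L = 0) (hm : m < 0) :
    ∃ x ∈ Ioo 0 L, 0 < f x := by
  have h1 : HasDerivWithinAt f m (Ioo 0 L) L := hf.mono Ioo_subset_Icc_self
  rw [hasDerivWithinAt_iff_tendsto_slope' (by simp)] at h1
  have h2 := h1.eventually_lt_const hm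
  have : (nhdsWithin (L : ℝ) (Ioo 0 L)).NeBot := right_nhdsWithin_Ioo_neBot hL
  obtain ⟨x, hx, hx'⟩ := (h2.and self_mem_nhdsWithin).exists
  refine ⟨x, hx', ?_⟩
  rw [slope_def_field, h0, sub_zero, div_lt_iff_of_neg (by linarith [hx'.2])] at hx
  linarith

namespace IsPhaseSolution

variable {a L p lam : ℝ} {u v : ℝ → ℝ}

lemma hasDerivAt_fst (h : IsPhaseSolution a L p lam u v) {x : ℝ} (hx : x ∈ Ioo 0 L) :
    HasDerivAt u (v x) x :=
  (h.deriv_fst x (Ioo_subset_Icc_self hx)).hasDerivAt (Icc_mem_nhds hx.1 hx.2)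

lemma hasDerivAt_snd (h : IsPhaseSolution a L p lam u v) {x : ℝ} (hx : x ∈ Ioo 0 L) :
    HasDerivAt v (a * u x ^ p - lam * u x) x :=
  (h.deriv_snd x (Ioo_subset_Icc_self hx)).hasDerivAt (Icc_mem_nhds hx.1 hx.2)

lemma continuousOn (h : IsPhaseSolution a L p lam u v) : ContinuousOn u (Icc 0 L) :=
  fun x hx => (h.deriv_fst x hx).continuousWithinAt

lemma energy_eq (h : IsPhaseSolution a L p lam u v) (hL : 0 < L) (hp0 : 0 < p)
    {x : ℝ} (hx : x ∈ Icc 0 L) : energy a p lam (u x) (v x) = v 0 ^ 2 / 2 := by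
  have hd : ∀ x ∈ Icc 0 L,
      HasDerivWithinAt (fun x => energy a p lam (u x) (v x)) 0 (Icc 0 L) x := by
    intro x hx
    have h1 := ((h.deriv_snd x hx).pow 2).div_const 2
    have h2 := (((h.deriv_fst x hx).pow 2).const_mul lam).div_const 2
    have h3 := (((h.deriv_fst x hx).rpow_const (p := p + 1) (Or.inr (by linarith))).const_mul
      a).div_const (p + 1)
    refine ((h1.add h2).sub h3).congr_deriv ?_
    have : p + 1 ≠ 0 := by positivity
    simp only [add_sub_cancel_right]
    field_simp
    simp
    ring
  have := constant_of_derivWithin_zero (fun x hx => (hd x hx).differentiableWithinAt)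
    (fun x hx => (hd x (Ico_subset_Icc_self hx)).derivWithin
      (uniqueDiffOn_Icc hL x (Ico_subset_Icc_self hx))) x hx
  rw [this]
  simp [energy, h.left, Real.zero_rpow (by positivity : p + 1 ≠ 0)]

lemma snd_eq_zero (h : IsPhaseSolution a L p lam u v) {x : ℝ} (hx : x ∈ Ioo 0 L)
    (hux : u x = 0) : v x = 0 := by
  refine IsLocalMin.hasDerivAt_eq_zero (f := u) ?_ (h.hasDerivAt_fst hx)
  filter_upwards [Icc_mem_nhds hx.1 hx.2] with y hy
  rw [hux]
  exact h.nonneg y hy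

lemma hasDerivAt_rpow (h : IsPhaseSolution a L p lam u v) {x : ℝ} (hx : x ∈ Ioo 0 L)
    (hux : 0 < u x) (k : ℝ) : HasDerivAt (fun x => u x ^ k) (k * (u x ^ (k - 1) * v x)) x := by
  convert (h.hasDerivAt_fst hx).rpow_const (p := k) (Or.inl hux.ne') using 1
  ring

/-- The power `u ^ ((1 - p) / 2)` satisfies a linear oscillator equation, up to an energy term. -/
lemma hasDerivAt_rpow_mul (h : IsPhaseSolution a L p lam u v) (hL : 0 < L) (hp0 : 0 < p)
    {x : ℝ} (hx : x ∈ Ioo 0 L) (hux : 0 < u x) {k : ℝ} (hk : k = (1 - p) / 2) :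
    HasDerivAt (fun x => k * (u x ^ (k - 1) * v x))
      (-(k ^ 2 * lam) * u x ^ k - k * (1 - k) * v 0 ^ 2 * u x ^ (k - 2)) x := by
  have h1 := (((h.hasDerivAt_rpow hx hux (k - 1)).mul (h.hasDerivAt_snd hx)).const_mul k)
  refine (h1).congr_deriv ?_
  have hE := h.energy_eq hL hp0 (Ioo_subset_Icc_self hx)
  have e1 : u x ^ (k - 1 - 1) = u x ^ (k - 2) := by congr 1; ring
  have e2 : u x ^ (k - 1) = u x ^ (k - 2) * u x := by
    rw [← Real.rpow_add_one hux.ne']; congr 1; ring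
  have e3 : u x ^ k = u x ^ (k - 2) * u x * u x := by
    rw [← e2, ← Real.rpow_add_one hux.ne']; congr 1; ring
  have e4 : u x ^ (p + 1) = u x ^ p * u x := Real.rpow_add_one hux.ne' p
  rw [energy, e4] at hE
  rw [e1, e3, e2]
  have hp : p = 1 - 2 * k := by linarith
  have hp1 : p + 1 ≠ 0 := by positivity
  have hv : v 0 ^ 2 = v x ^ 2 + lam * u x ^ 2 - 2 * a * (u x ^ p * u x) / (p + 1) := by
    linear_combination (-2) * hE
  rw [hv]
  have h1k : 1 - k = (p + 1) / 2 := by linarith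
  have h1k' : k - 1 = -((p + 1) / 2) := by linarith
  rw [h1k, h1k']
  field_simp
  rw [hk]
  ring

lemma pos_of_snd_ne_zero (h : IsPhaseSolution a L p lam u v) (hL : 0 < L) (hp0 : 0 < p)
    (hv : v 0 ≠ 0) : ∀ x ∈ Ioo 0 L, 0 < u x := by
  intro x hx
  refine lt_of_le_of_ne (h.nonneg x (Ioo_subset_Icc_self hx)) fun h0 => hv ?_
  have hE := h.energy_eq hL hp0 (Ioo_subset_Icc_self hx)
  rw [h.snd_eq_zero hx h0.symm, ← h0] at hE
  simpa [energy, Real.zero_rpow (by positivity : p + 1 ≠ 0)] using hE.symm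

lemma snd_left_pos (h : IsPhaseSolution a L p lam u v) (hL : 0 < L) (hv : v 0 ≠ 0) :
    0 < v 0 := by
  refine lt_of_le_of_ne (not_lt.1 fun hneg => ?_) hv.symm
  obtain ⟨x, hx, hx'⟩ := exists_neg_of_hasDerivWithinAt_left
    (h.deriv_fst 0 (left_mem_Icc.2 hL.le)) h.left hneg hL le_rfl
  linarith [h.nonneg x (Ioo_subset_Icc_self hx)]

lemma snd_right_neg (h : IsPhaseSolution a L p lam u v) (hL : 0 < L) (hp0 : 0 < p)
    (hv : v 0 ≠ 0) : v L < 0 := by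
  have hLm : L ∈ Icc 0 L := right_mem_Icc.2 hL.le
  refine lt_of_le_of_ne (not_lt.1 fun hpos => ?_) fun h0 => hv ?_
  · obtain ⟨x, hx, hx'⟩ := exists_pos_of_hasDerivWithinAt_right hL
      (h.deriv_fst L hLm).neg (by simp [h.right]) (neg_lt_zero.2 hpos)
    have := h.nonneg x (Ioo_subset_Icc_self hx)
    simp only [Pi.neg_apply] at hx'
    linarith
  · have hE := h.energy_eq hL hp0 hLm
    rw [h.right, h0] at hE
    simpa [energy, Real.zero_rpow (by positivity : p + 1 ≠ 0)] using hE.symm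

lemma lower_bound (h : IsPhaseSolution a L p lam u v) (ha : 0 < a) (hL : 0 < L)
    (hpos : ∀ x ∈ Ioo 0 L, 0 < u x) : (Real.pi / L) ^ 2 < lam := by
  by_contra! hle
  set q := Real.pi / L with hq
  have hqL : q * L = Real.pi := by rw [hq]; field_simp
  have hlin : ∀ x, HasDerivAt (fun x => q * x) q x := fun x => by
    simpa using (hasDerivAt_id x).const_mul q
  set W : ℝ → ℝ := fun x => v x * Real.sin (q * x) - u x * (q * Real.cos (q * x)) with hW
  have hWd : ∀ x ∈ Icc 0 L, HasDerivWithinAt W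
      ((a * u x ^ p + (q ^ 2 - lam) * u x) * Real.sin (q * x)) (Icc 0 L) x := by
    intro x hx
    have h1 := (h.deriv_snd x hx).mul (hlin x).sin.hasDerivWithinAt
    have h2 := (h.deriv_fst x hx).mul ((hlin x).cos.const_mul q).hasDerivWithinAt
    refine (h1.sub h2).congr_deriv ?_
    ring
  have hmono : StrictMonoOn W (Icc 0 L) := by
    refine strictMonoOn_of_deriv_pos (convex_Icc 0 L)
      (fun x hx => (hWd x hx).continuousWithinAt) fun x hx => ?_
    rw [interior_Icc] at hx
    rw [((hWd x (Ioo_subset_Icc_self hx)).hasDerivAt (Icc_mem_nhds hx.1 hx.2)).deriv]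
    have hux := hpos x hx
    have hs : 0 < Real.sin (q * x) := by
      have : 0 < q := by positivity
      refine Real.sin_pos_of_pos_of_lt_pi (mul_pos this hx.1) ?_
      rw [← hqL]
      exact mul_lt_mul_of_pos_left hx.2 this
    have h1 : 0 < a * u x ^ p := by positivity
    have h2 : 0 ≤ (q ^ 2 - lam) * u x := mul_nonneg (by linarith) hux.le
    positivity
  have := hmono (left_mem_Icc.2 hL.le) (right_mem_Icc.2 hL.le) hL
  simp [hW, h.left, h.right, hqL] at this

lemma upper_bound (h : IsPhaseSolution a L p lam u v) (hL : 0 < L)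
    (hp0 : 0 < p) (hp1 : p < 1) (hv : v 0 ≠ 0) :
    lam < (2 / (1 - p)) ^ 2 * (Real.pi / L) ^ 2 := by
  by_contra! hle
  have hpos := h.pos_of_snd_ne_zero hL hp0 hv
  set q := Real.pi / L with hq
  have hq0 : 0 < q := by positivity
  have hqL : q * L = Real.pi := by rw [hq]; field_simp
  obtain ⟨k, hk⟩ : ∃ k, k = (1 - p) / 2 := ⟨_, rfl⟩
  have hk0 : 0 < k := by linarith
  have hk1 : k < 1 := by linarith
  have hqk : q ^ 2 ≤ k ^ 2 * lam := by
    have h2 : 2 / (1 - p) = 1 / k := by rw [hk]; field_simp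
    rw [h2] at hle
    calc q ^ 2 = k ^ 2 * ((1 / k) ^ 2 * q ^ 2) := by field_simp
      _ ≤ _ := by gcongr
  have hlin : ∀ x, HasDerivAt (fun x => q * x) q x := fun x => by
    simpa using (hasDerivAt_id x).const_mul q
  set Z : ℝ → ℝ := fun x => k * v x * Real.sin (q * x) - u x * (q * Real.cos (q * x)) with hZ
  have hZd : ∀ x ∈ Icc 0 L, HasDerivWithinAt Z
      ((k * (a * u x ^ p - lam * u x) + q ^ 2 * u x) * Real.sin (q * x)
        - (1 - k) * (v x * (q * Real.cos (q * x)))) (Icc 0 L) x := by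
    intro x hx
    have h1 := ((h.deriv_snd x hx).const_mul k).mul (hlin x).sin.hasDerivWithinAt
    have h2 := (h.deriv_fst x hx).mul ((hlin x).cos.const_mul q).hasDerivWithinAt
    refine (h1.sub h2).congr_deriv ?_
    ring
  set W : ℝ → ℝ := fun x => u x ^ (k - 1) * Z x with hW
  have hWanti : AntitoneOn W (Ioo 0 L) := by
    have hWd : ∀ x ∈ Ioo 0 L, HasDerivAt W
        (-((k ^ 2 * lam - q ^ 2) * u x ^ k + k * (1 - k) * v 0 ^ 2 * u x ^ (k - 2))
          * Real.sin (q * x)) x := by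
      intro x hx
      have h1 := (h.hasDerivAt_rpow_mul hL hp0 hx (hpos x hx) hk).mul (hlin x).sin
      have h2 := (h.hasDerivAt_rpow hx (hpos x hx) k).mul ((hlin x).cos.const_mul q)
      have h3 := h1.sub h2
      refine (h3.congr_of_eventuallyEq ?_).congr_deriv (by ring)
      filter_upwards [Ioo_mem_nhds hx.1 hx.2] with y hy
      have e : u y ^ k = u y ^ (k - 1) * u y := by
        rw [← Real.rpow_add_one (hpos y hy).ne']; congr 1; ring
      simp only [hW, hZ, Pi.sub_apply, Pi.mul_apply]
      rw [e]
      ring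
    refine antitoneOn_of_deriv_nonpos (convex_Ioo 0 L)
      (fun x hx => (hWd x hx).continuousAt.continuousWithinAt)
      (fun x hx => ?_) fun x hx => ?_
    · rw [interior_Ioo] at hx
      exact (hWd x hx).differentiableAt.differentiableWithinAt
    · rw [interior_Ioo] at hx
      rw [(hWd x hx).deriv]
      have hux := hpos x hx
      have hs : 0 ≤ Real.sin (q * x) := by
        refine Real.sin_nonneg_of_nonneg_of_le_pi (mul_pos hq0 hx.1).le ?_
        rw [← hqL]
        exact mul_le_mul_of_nonneg_left hx.2.le hq0.le
      have h1 : 0 ≤ (k ^ 2 * lam - q ^ 2) * u x ^ k :=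
        mul_nonneg (by linarith) (by positivity)
      have h2 : 0 ≤ k * (1 - k) * v 0 ^ 2 * u x ^ (k - 2) :=
        mul_nonneg (mul_nonneg (mul_nonneg hk0.le (by linarith)) (sq_nonneg _)) (by positivity)
      rw [neg_mul]
      exact neg_nonpos.2 (mul_nonneg (by linarith) hs)
  have hd0 := hZd 0 (left_mem_Icc.2 hL.le)
  have hdL := hZd L (right_mem_Icc.2 hL.le)
  have hv0 := h.snd_left_pos hL hv
  have hvL := h.snd_right_neg hL hp0 hv
  obtain ⟨x₂, hx₂, hZ₂⟩ := exists_pos_of_hasDerivWithinAt_right hL hdL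
    (by simp [hZ, h.right, hqL]) (by
      simp only [hqL, Real.sin_pi, Real.cos_pi]
      have : 0 < (1 - k) * (-v L * q) := mul_pos (by linarith) (mul_pos (by linarith) hq0)
      linarith)
  obtain ⟨x₁, hx₁, hZ₁⟩ := exists_neg_of_hasDerivWithinAt_left hd0
    (by simp [hZ, h.left]) (by
      simp only [mul_zero, Real.sin_zero, Real.cos_zero]
      have : 0 < (1 - k) * (v 0 * q) := mul_pos (by linarith) (mul_pos hv0 hq0)
      linarith) hx₂.1 hx₂.2.le
  have hx₁' : x₁ ∈ Ioo 0 L := ⟨hx₁.1, hx₁.2.trans hx₂.2⟩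
  have hle := hWanti hx₁' hx₂ hx₁.2.le
  have h1 : W x₁ < 0 := mul_neg_of_pos_of_neg (Real.rpow_pos_of_pos (hpos _ hx₁') _) hZ₁
  have h2 : 0 < W x₂ := mul_pos (Real.rpow_pos_of_pos (hpos _ hx₂) _) hZ₂
  linarith

lemma exists_positive_component (h : IsPhaseSolution a L p lam u v) {t : ℝ} (ht : t ∈ Icc 0 L)
    (hut : 0 < u t) : ∃ α β, 0 ≤ α ∧ β ≤ L ∧ t ∈ Ioo α β ∧ u α = 0 ∧ u β = 0 ∧
      ∀ x ∈ Ioo α β, 0 < u x := by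
  have hz : ∀ c d, 0 ≤ c → d ≤ L → IsCompact (Icc c d ∩ u ⁻¹' {0}) := fun c d hc hd =>
    isCompact_Icc.of_isClosed_subset ((h.continuousOn.mono
      (Icc_subset_Icc hc hd)).preimage_isClosed_of_isClosed isClosed_Icc isClosed_singleton)
      inter_subset_left
  obtain ⟨α, ⟨⟨hα, hαt⟩, huα⟩, hαm⟩ := (hz 0 t le_rfl ht.2).exists_isGreatest
    ⟨0, left_mem_Icc.2 ht.1, h.left⟩
  obtain ⟨β, ⟨⟨hβt, hβ⟩, huβ⟩, hβm⟩ := (hz t L ht.1 le_rfl).exists_isLeast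
    ⟨L, right_mem_Icc.2 ht.2, h.right⟩
  simp only [mem_preimage, mem_singleton_iff] at huα huβ
  refine ⟨α, β, hα, hβ, ⟨lt_of_le_of_ne hαt ?_, lt_of_le_of_ne hβt ?_⟩, huα, huβ, ?_⟩
  · rintro rfl; exact hut.ne' huα
  · rintro rfl; exact hut.ne' huβ
  · intro x hx
    refine lt_of_le_of_ne (h.nonneg x ⟨hα.trans hx.1.le, hx.2.le.trans hβ⟩) fun h0 => ?_
    rcases le_total x t with hxt | hxt
    · exact hx.1.not_ge (hαm ⟨⟨hα.trans hx.1.le, hxt⟩, h0.symm⟩)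
    · exact hx.2.not_ge (hβm ⟨⟨hxt, hx.2.le.trans hβ⟩, h0.symm⟩)

/-- At zero energy every rest point with `u > 0` is at the height of the homoclinic. -/
lemma eq_uH_of_snd_eq_zero (h : IsPhaseSolution a L p lam u v) (hL : 0 < L) (hp0 : 0 < p)
    (hp1 : p < 1) (hlam : 0 < lam) (hv : v 0 = 0) {c : ℝ} (hc : c ∈ Icc 0 L)
    (huc : 0 < u c) (hvc : v c = 0) : u c = uH a p lam := by
  have hE := h.energy_eq hL hp0 hc
  have e : u c ^ (p + 1) * u c ^ (1 - p) = u c ^ 2 := by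
    rw [← Real.rpow_add huc, ← Real.rpow_natCast]
    congr 1
    push_cast
    ring
  have hpos : 0 < u c ^ (p + 1) := by positivity
  rw [energy, hvc, hv, ← e] at hE
  have h1 : u c ^ (1 - p) = 2 * a / ((p + 1) * lam) := by
    have hp : 0 < p + 1 := by positivity
    field_simp at hE ⊢
    have : u c ^ (p + 1) * (u c ^ (1 - p) * (p + 1) * lam - 2 * a) = 0 := by
      linear_combination hE
    rcases mul_eq_zero.1 this with h | h
    · exact absurd h hpos.ne'
    · linarith
  rw [uH, ← h1, ← Real.rpow_mul huc.le, mul_one_div, div_self (by linarith), Real.rpow_one]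

lemma exists_bump (h : IsPhaseSolution a L p lam u v) (hL : 0 < L) (hp0 : 0 < p)
    (hp1 : p < 1) (hlam : 0 < lam) (hv : v 0 = 0) {t : ℝ} (ht : t ∈ Icc 0 L) (hut : 0 < u t) :
    ∃ c, TH p lam ≤ c ∧ c ≤ L - TH p lam ∧ |t - c| < TH p lam ∧
      ∀ x, |x - c| ≤ TH p lam → u x = uhat a p lam (x - c) := by
  obtain ⟨α, β, hα, hβ, htαβ, huα, huβ, hpos⟩ := h.exists_positive_component ht hut
  have hsub : ∀ x ∈ Ioo α β, x ∈ Ioo 0 L := fun x hx =>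
    ⟨hα.trans_lt hx.1, hx.2.trans_le hβ⟩
  have hcont : ContinuousOn u (Icc α β) := h.continuousOn.mono (Icc_subset_Icc hα hβ)
  obtain ⟨c, hc, hmax⟩ := isCompact_Icc.exists_isMaxOn ⟨t, Ioo_subset_Icc_self htαβ⟩ hcont
  have huc : 0 < u c := hut.trans_le (hmax (Ioo_subset_Icc_self htαβ))
  have hc' : c ∈ Ioo α β := by
    refine ⟨lt_of_le_of_ne hc.1 ?_, lt_of_le_of_ne hc.2 ?_⟩
    · rintro rfl; exact huc.ne' huα
    · rintro rfl; exact huc.ne' huβ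
  have hvc : v c = 0 := (hmax.isLocalMax (Icc_mem_nhds hc'.1 hc'.2)).hasDerivAt_eq_zero
    (h.hasDerivAt_fst (hsub c hc'))
  have hucH := h.eq_uH_of_snd_eq_zero hL hp0 hp1 hlam hv (Ioo_subset_Icc_self (hsub c hc')) huc hvc
  obtain ⟨k, hk⟩ : ∃ k, k = (1 - p) / 2 := ⟨_, rfl⟩
  have hk0 : 0 < k := by linarith
  have hs : 0 < Real.sqrt lam := Real.sqrt_pos.2 hlam
  set ω := k * Real.sqrt lam with hω
  have hω0 : 0 < ω := by positivity
  have hω2 : ω ^ 2 = k ^ 2 * lam := by rw [hω, mul_pow, Real.sq_sqrt hlam.le]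
  have hT : ω * TH p lam = Real.pi / 2 := by
    have : 1 - p = 2 * k := by linarith
    rw [TH, this, hω]
    field_simp
  have hT0 : 0 < TH p lam := pos_of_mul_pos_right (by rw [hT]; positivity) hω0.le
  have hcos : ∀ x ∈ Ioo α β, u x ^ k = u c ^ k * Real.cos (ω * (x - c)) := by
    intro x hx
    refine eq_cos_of_oscillator (w := fun x => u x ^ k) (z := fun x => k * (u x ^ (k - 1) * v x))
      hω0.ne' hc' (fun y hy => h.hasDerivAt_rpow (hsub y hy) (hpos y hy) k)
      (fun y hy => ?_) (by simp [hvc]) hx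
    refine (h.hasDerivAt_rpow_mul hL hp0 (hsub y hy) (hpos y hy) hk).congr_deriv ?_
    rw [hω2, hv]
    ring
  have hcos' : ∀ x ∈ Icc α β, u x ^ k = u c ^ k * Real.cos (ω * (x - c)) := by
    have hαβ : α < β := hc'.1.trans hc'.2
    rw [← closure_Ioo hαβ.ne]
    refine fun x hx => (show EqOn (fun x => u x ^ k)
      (fun x => u c ^ k * Real.cos (ω * (x - c))) (Ioo α β) from hcos).of_subset_closure
      ?_ ?_ Ioo_subset_Icc_self ?_ (by rwa [closure_Ioo hαβ.ne] at hx)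
    · exact hcont.rpow_const fun x _ => Or.inr hk0.le
    · fun_prop
    · rw [closure_Ioo hαβ.ne]
  have hzero : ∀ x ∈ Icc α β, u x = 0 → TH p lam ≤ |x - c| := by
    intro x hx hux
    by_contra! hlt
    have h1 := hcos' x hx
    rw [hux, Real.zero_rpow hk0.ne'] at h1
    have h2 : |ω * (x - c)| < Real.pi / 2 := by
      rw [abs_mul, abs_of_pos hω0, ← hT]
      exact mul_lt_mul_of_pos_left hlt hω0
    have h3 := Real.cos_pos_of_mem_Ioo (abs_lt.1 h2)
    have : 0 < u c ^ k * Real.cos (ω * (x - c)) := by positivity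
    linarith
  have hβT : β = c + TH p lam := by
    have h1 := hzero β ⟨hc'.1.le.trans hc'.2.le, le_rfl⟩ huβ
    rw [abs_of_pos (by linarith [hc'.2])] at h1
    refine le_antisymm (not_lt.1 fun hlt => ?_) (by linarith)
    have hm : c + TH p lam ∈ Ioo α β := ⟨by linarith [hc'.1], hlt⟩
    have h2 := hcos _ hm
    rw [add_sub_cancel_left, hT, Real.cos_pi_div_two, mul_zero] at h2
    exact (Real.rpow_pos_of_pos (hpos _ hm) k).ne' h2
  have hαT : α = c - TH p lam := by
    have h1 := hzero α ⟨le_rfl, hc'.1.le.trans hc'.2.le⟩ huα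
    rw [abs_of_neg (by linarith [hc'.1])] at h1
    refine le_antisymm (by linarith) (not_lt.1 fun hlt => ?_)
    have hm : c - TH p lam ∈ Ioo α β := ⟨hlt, by linarith [hc'.2]⟩
    have h2 := hcos _ hm
    rw [sub_sub_cancel_left, mul_neg, hT, Real.cos_neg, Real.cos_pi_div_two, mul_zero] at h2
    exact (Real.rpow_pos_of_pos (hpos _ hm) k).ne' h2
  refine ⟨c, by linarith, by linarith, abs_lt.2 ⟨?_, ?_⟩, fun x hx => ?_⟩
  · linarith [htαβ.1]
  · linarith [htαβ.2]
  · have hx' := abs_le.1 hx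
    have hxm : x ∈ Icc α β := ⟨by linarith, by linarith⟩
    have hux : 0 ≤ u x := h.nonneg x ⟨hα.trans hxm.1, hxm.2.trans hβ⟩
    have hcx : 0 ≤ Real.cos (ω * (x - c)) := by
      refine Real.cos_nonneg_of_mem_Icc (abs_le.1 ?_)
      rw [abs_mul, abs_of_pos hω0, ← hT]
      exact mul_le_mul_of_nonneg_left hx hω0.le
    have hkk : 2 / (1 - p) = k⁻¹ := by rw [hk]; field_simp
    have harg : (1 - p) * Real.sqrt lam * (x - c) / 2 = ω * (x - c) := by rw [hω, hk]; ring
    rw [uhat, if_pos hx, hkk, harg, ← hucH, ← Real.rpow_rpow_inv huc.le hk0.ne',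
      ← Real.mul_rpow (by positivity) hcx, ← hcos' x hxm,
      Real.rpow_rpow_inv hux hk0.ne']

end IsPhaseSolution

lemma TH_pos {p lam : ℝ} (hp1 : p < 1) (hlam : 0 < lam) : 0 < TH p lam :=
  div_pos Real.pi_pos (mul_pos (by linarith) (Real.sqrt_pos.2 hlam))

lemma uhat_eq_zero {a p lam x : ℝ} (hp1 : p < 1) (hlam : 0 < lam) (hx : TH p lam ≤ |x|) :
    uhat a p lam x = 0 := by
  rcases hx.eq_or_lt with hx | hx
  · have hs : 0 < Real.sqrt lam := Real.sqrt_pos.2 hlam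
    have hq : 0 < 1 - p := by linarith
    have habs : |(1 - p) * Real.sqrt lam * x / 2| = Real.pi / 2 := by
      rw [abs_div, abs_mul, abs_of_pos (by positivity : 0 < (1 - p) * Real.sqrt lam), ← hx, TH,
        abs_two]
      field_simp
    rw [uhat, if_pos hx.ge, ← Real.cos_abs, habs, Real.cos_pi_div_two,
      Real.zero_rpow (by positivity), mul_zero]
  · rw [uhat, if_neg hx.not_ge]

lemma uhat_pos {a p lam x : ℝ} (ha : 0 < a) (hp0 : 0 < p) (hp1 : p < 1) (hlam : 0 < lam)
    (hx : |x| < TH p lam) : 0 < uhat a p lam x := by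
  have hs : 0 < Real.sqrt lam := Real.sqrt_pos.2 hlam
  have hq : 0 < 1 - p := by linarith
  have habs : |(1 - p) * Real.sqrt lam * x / 2| < Real.pi / 2 := by
    rw [abs_div, abs_mul, abs_of_pos (by positivity : 0 < (1 - p) * Real.sqrt lam), abs_two]
    rw [TH, lt_div_iff₀ (by positivity)] at hx
    linarith
  have hc := Real.cos_pos_of_mem_Ioo (abs_lt.1 habs)
  have hH : 0 < uH a p lam := by rw [uH]; positivity
  rw [uhat, if_pos hx.le]
  positivity

lemma Set.finite_of_separated {C : Set ℝ} {d L : ℝ} (hd : 0 < d) (hC : C ⊆ Icc 0 L)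
    (hsep : ∀ c ∈ C, ∀ c' ∈ C, c < c' → d ≤ c' - c) : C.Finite := by
  refine Set.Finite.of_finite_image (f := fun c => ⌊c / d⌋)
    ((Set.finite_Icc 0 ⌊L / d⌋).subset ?_) ?_
  · rintro _ ⟨c, hc, rfl⟩
    exact ⟨Int.floor_nonneg.2 (div_nonneg (hC hc).1 hd.le),
      Int.floor_mono (div_le_div_of_nonneg_right (hC hc).2 hd.le)⟩
  · have key : ∀ c ∈ C, ∀ c' ∈ C, c < c' → ⌊c / d⌋ ≠ ⌊c' / d⌋ := by
      intro c hc c' hc' hlt heq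
      have h1 := Int.abs_sub_lt_one_of_floor_eq_floor heq
      rw [abs_sub_comm, ← sub_div, abs_of_pos (div_pos (by linarith) hd), div_lt_one hd] at h1
      linarith [hsep c hc c' hc' hlt]
    intro c hc c' hc' heq
    rcases lt_trichotomy c c' with h | h | h
    · exact absurd heq (key c hc c' hc' h)
    · exact h
    · exact absurd heq.symm (key c' hc' c hc h)

lemma IsPhaseSolution.exists_bumps {a L p lam : ℝ} {u v : ℝ → ℝ}
    (h : IsPhaseSolution a L p lam u v) (ha : 0 < a) (hL : 0 < L) (hp0 : 0 < p)
    (hp1 : p < 1) (hlam : 0 < lam) (hv : v 0 = 0) (hne : ∃ x ∈ Icc 0 L, u x ≠ 0) :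
    ∃ j : ℕ, ∃ hj : 0 < j, ∃ x : Fin j → ℝ, AdmissibleBumps L p lam j hj x ∧
      ∀ t ∈ Icc (0 : ℝ) L, u t = ∑ i, uhat a p lam (t - x i) := by
  have hT := TH_pos hp1 hlam
  set C : Set ℝ := {c | TH p lam ≤ c ∧ c ≤ L - TH p lam ∧
    ∀ x, |x - c| ≤ TH p lam → u x = uhat a p lam (x - c)} with hC
  have hsep : ∀ c ∈ C, ∀ c' ∈ C, c < c' → 2 * TH p lam ≤ c' - c := by
    intro c hc c' hc' hlt
    by_contra! hd
    have h1 : |c + TH p lam - c'| < TH p lam := abs_lt.2 ⟨by linarith, by linarith⟩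
    have h2 : |c + TH p lam - c| = TH p lam := by rw [add_sub_cancel_left, abs_of_pos hT]
    have h3 := uhat_pos ha hp0 hp1 hlam h1
    rw [← hc'.2.2 _ h1.le, hc.2.2 _ h2.le, uhat_eq_zero hp1 hlam h2.ge] at h3
    exact h3.false
  have hfin : C.Finite := Set.finite_of_separated (L := L) (mul_pos two_pos hT)
    (fun c hc => ⟨hT.le.trans hc.1, hc.2.1.trans (by linarith)⟩) hsep
  set S := hfin.toFinset with hS
  have hmem : ∀ c, c ∈ S ↔ c ∈ C := fun c => hfin.mem_toFinset
  have hbump : ∀ t ∈ Icc 0 L, 0 < u t → ∃ c ∈ C, |t - c| < TH p lam := by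
    intro t ht hut
    obtain ⟨c, h1, h2, h3, h4⟩ := h.exists_bump hL hp0 hp1 hlam hv ht hut
    exact ⟨c, ⟨h1, h2, h4⟩, h3⟩
  have hj : 0 < S.card := by
    obtain ⟨t, ht, hut⟩ := hne
    obtain ⟨c, hc, -⟩ := hbump t ht ((h.nonneg t ht).lt_of_ne' hut)
    exact Finset.card_pos.2 ⟨c, (hmem c).2 hc⟩
  set x := S.orderEmbOfFin rfl with hx
  have hxC : ∀ i, x i ∈ C := fun i => (hmem _).1 (S.orderEmbOfFin_mem rfl i)
  refine ⟨S.card, hj, x, ⟨x.strictMono, fun i => ⟨hT.trans_le (hxC i).1,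
    (hxC i).2.1.trans_lt (by linarith)⟩, (hxC _).1, fun i hi =>
    hsep _ (hxC _) _ (hxC _) (x.strictMono (Fin.lt_def.2 (Nat.lt_succ_self _))),
    (hxC _).2.1⟩, fun t ht => ?_⟩
  rcases (h.nonneg t ht).eq_or_lt with h0 | hpos
  · rw [← h0, eq_comm]
    refine Finset.sum_eq_zero fun i _ => ?_
    rcases le_total (|t - x i|) (TH p lam) with hle | hge
    · rw [← (hxC i).2.2 t hle, h0]
    · exact uhat_eq_zero hp1 hlam hge
  · obtain ⟨c, hc, htc⟩ := hbump t ht hpos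
    obtain ⟨i, rfl⟩ : c ∈ Set.range x := by
      rw [hx, Finset.range_orderEmbOfFin]
      exact (hmem c).2 hc
    rw [Finset.sum_eq_single i]
    · exact hc.2.2 t htc.le
    · intro b _ hb
      refine uhat_eq_zero hp1 hlam ?_
      have h1 := abs_lt.1 htc
      rcases lt_or_gt_of_ne (x.injective.ne hb) with hlt | hlt
      · have := hsep _ (hxC b) _ hc hlt
        exact le_abs.2 (Or.inl (by linarith))
      · have := hsep _ hc _ (hxC b) hlt
        exact le_abs.2 (Or.inr (by linarith))
    · simp

lemma AdmissibleBumps.two_TH_le {L p lam : ℝ} {j : ℕ} {hj : 0 < j} {x : Fin j → ℝ}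
    (hx : AdmissibleBumps L p lam j hj x) : 2 * TH p lam ≤ L := by
  obtain ⟨hmono, -, hl, -, hr⟩ := hx
  have : x ⟨0, hj⟩ ≤ x ⟨j - 1, Nat.sub_lt hj Nat.one_pos⟩ :=
    hmono.monotone (Fin.le_def.2 (Nat.zero_le _))
  linarith

lemma lt_two_TH {L p lam : ℝ} (hL : 0 < L) (hp1 : p < 1) (hlam : 0 < lam)
    (h : lam < (2 / (1 - p)) ^ 2 * (Real.pi / L) ^ 2) : L < 2 * TH p lam := by
  have hq : 0 < 1 - p := by linarith
  have hs : 0 < Real.sqrt lam := Real.sqrt_pos.2 hlam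
  rw [← mul_pow, ← Real.sqrt_lt hlam.le (by positivity)] at h
  rw [TH, mul_div_assoc', lt_div_iff₀ (by positivity)]
  rw [div_mul_div_comm, lt_div_iff₀ (by positivity)] at h
  linarith

theorem stmt18 (a L p lam : ℝ) (ha : 0 < a) (hL : 0 < L) (hp0 : 0 < p) (hp1 : p < 1)
    (hlam : 0 < lam) (u : ℝ → ℝ) (hu : IsNonnegSolution a L p lam u)
    (hne : ∃ x ∈ Set.Icc (0 : ℝ) L, u x ≠ 0) :
    Xor'
      (IsClassicalPositiveSolution a L p lam u ∧
        (Real.pi / L) ^ 2 < lam ∧ lam < (2 / (1 - p)) ^ 2 * (Real.pi / L) ^ 2)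
      (∃ j : ℕ, ∃ hj : 0 < j, ∃ x : Fin j → ℝ, AdmissibleBumps L p lam j hj x ∧
        ∀ t ∈ Set.Icc (0 : ℝ) L, u t = ∑ i, uhat a p lam (t - x i)) := by
  have h := hu.isPhaseSolution hL
  refine (xor_iff_or_and_not_and _ _).2 ⟨?_, ?_⟩
  · rcases eq_or_ne (derivWithin u (Set.Icc 0 L) 0) 0 with hv | hv
    · exact Or.inr (h.exists_bumps ha hL hp0 hp1 hlam hv hne)
    · have hpos := h.pos_of_snd_ne_zero hL hp0 hv
      exact Or.inl ⟨⟨hu, hpos, h.snd_left_pos hL hv, h.snd_right_neg hL hp0 hv⟩,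
        h.lower_bound ha hL hpos, h.upper_bound hL hp0 hp1 hv⟩
  · rintro ⟨⟨-, -, hub⟩, j, hj, x, hx, -⟩
    exact (lt_two_TH hL hp1 hlam hub).not_ge hx.two_TH_le
end
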